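/- arXiv:2007.06964 — 2 statements merged into one kernel-verified Lean document; each statement's English description precedes it below -/
import Mathlib

section
/- All solutions are push-forwards of the initial datum: Assume t ↦ ρ_t ∈ M⁺(ℝ^d) is a narrowly continuous solution of ∂_t ρ_t + div(v ρ_t) = g ρ_t in (0,1)×ℝ^d in the distributional sense, for Borel maps v : [0,1]×ℝ^d → ℝ^d, g : [0,1]×ℝ^d → ℝ satisfying ∫₀¹ (sup_{x∈ℝ^d}|v(t,x)| + Lip(v(t,·),ℝ^d)) dt < ∞, ∫₀¹ ∫_{ℝ^d} (|v(t,x)| + |g(t,x)|) d|ρ_t|(x) dt < ∞, and ∫₀¹ (sup_{x∈ℝ^d}|g(t,x)| + Lip(g(t,·),ℝ^d)) dt < ∞. Then for ρ₀-a.e. x ∈ ℝ^d the ODE X'(t) = v(t,X(t)), X(0) = x admits a global solution X_x(t) on [0,1], and for every t ∈ [0,1] one has ρ_t = (X_x(t))_#( ρ₀ · e^{∫₀^t g(s,X_x(s)) ds} ). -/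
open MeasureTheory Set Filter Topology
open scoped ENNReal NNReal

noncomputable section

namespace Paper

abbrev Euc (d : ℕ) : Type := EuclideanSpace ℝ (Fin d)

abbrev XX (d : ℕ) : Type := ℝ × Euc d

variable {d : ℕ}

/-- `Ω` is the closure of a bounded domain (a nonempty bounded open connected set). -/
def IsClosureOfBoundedDomain (Ω : Set (Euc d)) : Prop :=
  ∃ U : Set (Euc d), IsOpen U ∧ U.Nonempty ∧ IsConnected U ∧
    Bornology.IsBounded U ∧ Ω = closure U

/-- `Ω` is the closure of a bounded convex domain. -/
def IsClosureOfBoundedConvexDomain (Ω : Set (Euc d)) : Prop :=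
  ∃ U : Set (Euc d), IsOpen U ∧ U.Nonempty ∧ Convex ℝ U ∧
    Bornology.IsBounded U ∧ Ω = closure U

/-- clamping of `ℝ` onto `[0,1]`. -/
def clamp (t : ℝ) : ℝ := max 0 (min 1 t)

/-- `t ↦ ρ t` is a narrowly continuous curve (on `[0,1]`) of finite positive
measures concentrated on `Ω`, i.e. an element of `C_w([0,1]; M⁺(Ω))`. -/
def NarrowCurve (Ω : Set (Euc d)) (ρ : ℝ → Measure (Euc d)) : Prop :=
  (∀ t ∈ Icc (0:ℝ) 1, ρ t Ωᶜ = 0 ∧ ρ t Set.univ ≠ ⊤) ∧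
  (∀ φ : Euc d → ℝ, Continuous φ →
      ContinuousOn (fun t => ∫ x, φ x ∂(ρ t)) (Icc (0:ℝ) 1))

/-- Test functions for the continuity equation on `X_Ω = (0,1) × Ω` (no-flux form:
compact support in time, free at the spatial boundary). -/
def IsTest (φ : XX d → ℝ) : Prop :=
  ContDiff ℝ (⊤ : ℕ∞) φ ∧ HasCompactSupport φ ∧
    tsupport φ ⊆ Ioo (0:ℝ) 1 ×ˢ (Set.univ : Set (Euc d))

/-- Distributional solution of `∂ₜ ρ + div (v ρ) = g ρ`. -/
def SolvesCE (ρ : ℝ → Measure (Euc d)) (v : XX d → Euc d) (g : XX d → ℝ) : Prop :=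
  ∀ φ : XX d → ℝ, IsTest φ →
    (∫ t in Ioo (0:ℝ) 1,
      ∫ x, (fderiv ℝ φ (t, x) (1, v (t, x)) + φ (t, x) * g (t, x)) ∂(ρ t)) = 0

/-- The Hellinger–Kantorovich energy `∫₀¹ ∫ (|v|² + g²) dρ_t dt`. -/
def EnergyVG (ρ : ℝ → Measure (Euc d)) (v : XX d → Euc d) (g : XX d → ℝ) : ℝ≥0∞ :=
  ∫⁻ t in Ioo (0:ℝ) 1, ∫⁻ x, ENNReal.ofReal (‖v (t, x)‖ ^ 2 + g (t, x) ^ 2) ∂(ρ t)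

/-- The class `D_{v,g}` of finite-energy narrowly continuous solutions. -/
def Dvg (Ω : Set (Euc d)) (v : XX d → Euc d) (g : XX d → ℝ)
    (ρ : ℝ → Measure (Euc d)) : Prop :=
  NarrowCurve Ω ρ ∧ SolvesCE ρ v g ∧ EnergyVG ρ v g < ⊤

/-- total variation `‖ρ‖_{M(X_Ω)}` of `ρ = dt ⊗ ρ_t`. -/
def TVcurve (ρ : ℝ → Measure (Euc d)) : ℝ≥0∞ :=
  ∫⁻ t in Ioo (0:ℝ) 1, ρ t Set.univ

/-- The cone `𝒞_V = {h δ_γ : h ≥ 0, γ ∈ V}` of weighted Dirac masses. -/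
def coneSet (V : Set (Euc d)) : Set (Measure (Euc d)) :=
  {μ | ∃ (a : ℝ) (x : Euc d), 0 ≤ a ∧ x ∈ V ∧ μ = ENNReal.ofReal a • Measure.dirac x}

/-- The space `𝒮_V` of narrowly continuous curves `[0,1] → 𝒞_V`
(extended to `ℝ` by clamping). -/
structure SCurve (V : Set (Euc d)) where
  toFun : ℝ → Measure (Euc d)
  clamped : ∀ t, toFun t = toFun (clamp t)
  cone : ∀ t, toFun t ∈ coneSet V
  narrow : ∀ φ : Euc d → ℝ, Continuous φ → Continuous fun t => ∫ x, φ x ∂(toFun t)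

/-- The flat distance `D_F` between measures. -/
def flatDist (μ ν : Measure (Euc d)) : ℝ :=
  sSup {r : ℝ | ∃ φ : Euc d → ℝ, Continuous φ ∧ (∀ x, |φ x| ≤ 1) ∧ LipschitzWith 1 φ ∧
        r = (∫ x, φ x ∂μ) - ∫ x, φ x ∂ν}

/-- The supremum distance `D` on `𝒮_V`. -/
def Ddist {V : Set (Euc d)} (η₁ η₂ : SCurve V) : ℝ :=
  sSup {r : ℝ | ∃ t ∈ Icc (0:ℝ) 1, r = flatDist (η₁.toFun t) (η₂.toFun t)}

/-- The topology of `(𝒮_V, D)`, generated by the open `D`-balls. -/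
def Stop (V : Set (Euc d)) : TopologicalSpace (SCurve V) :=
  TopologicalSpace.generateFrom
    {s | ∃ (η₀ : SCurve V) (ε : ℝ), 0 < ε ∧ s = {η | Ddist η₀ η < ε}}

/-- The Borel σ-algebra of `(𝒮_V, D)`. -/
def Sborel (V : Set (Euc d)) : MeasurableSpace (SCurve V) := @borel _ (Stop V)

instance (V : Set (Euc d)) : MeasurableSpace (SCurve V) := Sborel V

/-- `‖h‖_∞` for a curve `ρ_t = h(t) δ_{γ(t)} ∈ 𝒮_V`. -/
def supMass {V : Set (Euc d)} (η : SCurve V) : ℝ≥0∞ :=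
  ⨆ t ∈ Icc (0:ℝ) 1, η.toFun t Set.univ

/-- `AC²[0,1]`: absolutely continuous on `[0,1]` with a.e. derivative in `L²`. -/
def AC2 {F : Type*} [NormedAddCommGroup F] [NormedSpace ℝ F] (f : ℝ → F) : Prop :=
  ∃ f' : ℝ → F, IntegrableOn f' (Icc (0:ℝ) 1) ∧
    IntegrableOn (fun t => ‖f' t‖ ^ 2) (Icc (0:ℝ) 1) ∧
    ∀ t ∈ Icc (0:ℝ) 1, f t = f 0 + ∫ s in (0:ℝ)..t, f' s

/-- `(γ, h)` represents the curve `η ∈ 𝒮_V`, i.e. `η_t = h(t) δ_{γ(t)}` on `[0,1]`. -/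
def Represents {V : Set (Euc d)} (η : SCurve V) (γ : ℝ → Euc d) (h : ℝ → ℝ) : Prop :=
  ∀ t ∈ Icc (0:ℝ) 1, 0 ≤ h t ∧ γ t ∈ V ∧
    η.toFun t = ENNReal.ofReal (h t) • Measure.dirac (γ t)

/-- The set `H_V ⊆ 𝒮_V` of curves `h(t)δ_{γ(t)}` with `h, √h ∈ AC²[0,1]`,
`√h γ ∈ AC²([0,1];ℝ^d)`. -/
def MemH (V : Set (Euc d)) (η : SCurve V) : Prop :=
  ∃ (γ : ℝ → Euc d) (h : ℝ → ℝ), Represents η γ h ∧ AC2 h ∧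
    AC2 (fun t => Real.sqrt (h t)) ∧ AC2 (fun t => Real.sqrt (h t) • γ t)

/-- The set `H_V^{v,g}`: curves in `H_V` solving the characteristic system
`γ' = v(t,γ)` a.e. on `{h>0}` and `h' = g(t,γ) h` a.e. on `(0,1)`. -/
def MemHvg (V : Set (Euc d)) (v : XX d → Euc d) (g : XX d → ℝ) (η : SCurve V) : Prop :=
  ∃ (γ : ℝ → Euc d) (h : ℝ → ℝ), Represents η γ h ∧ AC2 h ∧
    AC2 (fun t => Real.sqrt (h t)) ∧ AC2 (fun t => Real.sqrt (h t) • γ t) ∧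
    (∀ᵐ t ∂(volume.restrict {t | t ∈ Ioo (0:ℝ) 1 ∧ 0 < h t}),
        HasDerivAt γ (v (t, γ t)) t) ∧
    (∀ᵐ t ∂(volume.restrict (Ioo (0:ℝ) 1)),
        HasDerivAt h (g (t, γ t) * h t) t)

/-- The set `𝒮*_V` of curves whose positivity set `{h > 0}` is `[0,1] ∩ (-∞, τ)`. -/
def MemSstar {V : Set (Euc d)} (η : SCurve V) : Prop :=
  ∃ τ : ℝ, {t | t ∈ Icc (0:ℝ) 1 ∧ η.toFun t Set.univ ≠ 0} = Icc (0:ℝ) 1 ∩ Iio τ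

/-- The vanishing time `τ(γ,h) = min { t ∈ [0,1] : h(t) = 0 }` (`∞` if none). -/
def tauS {V : Set (Euc d)} (η : SCurve V) : ℝ≥0∞ :=
  sInf {c : ℝ≥0∞ | ∃ t ∈ Icc (0:ℝ) 1, η.toFun t Set.univ = 0 ∧ c = ENNReal.ofReal t}


open Classical in
/-- The integrand `Ψ_δ(t,x,y)`. -/
def Psi (δ : ℝ) (t : ℝ) (x : Euc d) (y : ℝ) : ℝ≥0∞ :=
  if 0 < t then ENNReal.ofReal ((‖x‖ ^ 2 + δ ^ 2 * y ^ 2) / (2 * t))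
  else if t = 0 ∧ x = 0 ∧ y = 0 then 0 else ⊤

/-- `u` is a density of the signed measure `σ` with respect to `lam`. -/
def IsDensityS (σ : SignedMeasure (XX d)) (lam : Measure (XX d)) (u : XX d → ℝ) : Prop :=
  ∀ s : Set (XX d), MeasurableSet s → σ s = ∫ x in s, u x ∂lam

/-- `w` is a density of the vector measure `m` with respect to `lam`. -/
def IsDensityV (m : VectorMeasure (XX d) (Euc d)) (lam : Measure (XX d))
    (w : XX d → Euc d) : Prop :=
  ∀ s : Set (XX d), MeasurableSet s → m s = ∫ x in s, w x ∂lam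

/-- `r` is a density of the positive measure `P` with respect to `lam`. -/
def IsDensityP (P : Measure (XX d)) (lam : Measure (XX d)) (r : XX d → ℝ) : Prop :=
  ∀ s : Set (XX d), MeasurableSet s → P s = ∫⁻ x in s, ENNReal.ofReal (r x) ∂lam

/-- `(P, m, μ)` is a measure solution of `∂ₜ ρ + div m = μ` (with `P` positive). -/
def SolvesCEMeas (P : Measure (XX d)) (m : VectorMeasure (XX d) (Euc d))
    (μ : SignedMeasure (XX d)) : Prop :=
  ∀ (lam : Measure (XX d)), IsFiniteMeasure lam →
    ∀ (w : XX d → Euc d) (u : XX d → ℝ), Measurable w → Measurable u →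
      IsDensityV m lam w → IsDensityS μ lam u →
      ∀ φ : XX d → ℝ, IsTest φ →
        ((∫ x, fderiv ℝ φ x ((1:ℝ), (0 : Euc d)) ∂P) +
          (∫ x, fderiv ℝ φ x ((0:ℝ), w x) ∂lam) + ∫ x, φ x * u x ∂lam) = 0

/-- The Wasserstein–Fisher–Rao energy `B_δ(ρ,m,μ)` for a positive `ρ`. -/
def BdeltaMeas (δ : ℝ) (P : Measure (XX d)) (m : VectorMeasure (XX d) (Euc d))
    (μ : SignedMeasure (XX d)) : ℝ≥0∞ :=
  sInf {c : ℝ≥0∞ | ∃ lam : Measure (XX d), IsFiniteMeasure lam ∧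
    ∃ (r : XX d → ℝ) (w : XX d → Euc d) (u : XX d → ℝ),
      Measurable r ∧ Measurable w ∧ Measurable u ∧ (∀ x, 0 ≤ r x) ∧
      IsDensityP P lam r ∧ IsDensityV m lam w ∧ IsDensityS μ lam u ∧
      c = ∫⁻ x, Psi δ (r x) (w x) (u x) ∂lam}

open Classical in
/-- The coercive energy `J_{α,β,δ}(ρ,m,μ)` for a positive `ρ`. -/
def JMeas (α β δ : ℝ) (P : Measure (XX d)) (m : VectorMeasure (XX d) (Euc d))
    (μ : SignedMeasure (XX d)) : ℝ≥0∞ :=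
  if SolvesCEMeas P m μ then
    ENNReal.ofReal β * BdeltaMeas δ P m μ + ENNReal.ofReal α * P Set.univ
  else ⊤

/-- `(ρ, m, μ)` is a measure solution of `∂ₜ ρ + div m = μ` (signed case). -/
def SolvesCESigned (ρ : SignedMeasure (XX d)) (m : VectorMeasure (XX d) (Euc d))
    (μ : SignedMeasure (XX d)) : Prop :=
  ∀ (lam : Measure (XX d)), IsFiniteMeasure lam →
    ∀ (r : XX d → ℝ) (w : XX d → Euc d) (u : XX d → ℝ),
      Measurable r → Measurable w → Measurable u →
      IsDensityS ρ lam r → IsDensityV m lam w → IsDensityS μ lam u →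
      ∀ φ : XX d → ℝ, IsTest φ →
        (∫ x, (fderiv ℝ φ x ((1:ℝ), (0 : Euc d)) * r x
          + fderiv ℝ φ x ((0:ℝ), w x) + φ x * u x) ∂lam) = 0

/-- The Wasserstein–Fisher–Rao energy `B_δ(ρ,m,μ)`, signed case. -/
def BdeltaSigned (δ : ℝ) (ρ : SignedMeasure (XX d)) (m : VectorMeasure (XX d) (Euc d))
    (μ : SignedMeasure (XX d)) : ℝ≥0∞ :=
  sInf {c : ℝ≥0∞ | ∃ lam : Measure (XX d), IsFiniteMeasure lam ∧
    ∃ (r : XX d → ℝ) (w : XX d → Euc d) (u : XX d → ℝ),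
      Measurable r ∧ Measurable w ∧ Measurable u ∧
      IsDensityS ρ lam r ∧ IsDensityV m lam w ∧ IsDensityS μ lam u ∧
      c = ∫⁻ x, Psi δ (r x) (w x) (u x) ∂lam}

open Classical in
/-- The coercive energy `J_{α,β,δ}(ρ,m,μ)`, signed case. -/
def JSigned (α β δ : ℝ) (ρ : SignedMeasure (XX d)) (m : VectorMeasure (XX d) (Euc d))
    (μ : SignedMeasure (XX d)) : ℝ≥0∞ :=
  if SolvesCESigned ρ m μ then
    ENNReal.ofReal β * BdeltaSigned δ ρ m μ
      + ENNReal.ofReal α * ρ.totalVariation Set.univ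
  else ⊤

/-- A signed measure on `X = ℝ × ℝ^d` is concentrated on `X_Ω = (0,1) × Ω`. -/
def ConcS (Ω : Set (Euc d)) (ρ : SignedMeasure (XX d)) : Prop :=
  ∀ s : Set (XX d), MeasurableSet s → s ⊆ (Ioo (0:ℝ) 1 ×ˢ Ω)ᶜ → ρ s = 0

/-- A vector measure on `X = ℝ × ℝ^d` is concentrated on `X_Ω = (0,1) × Ω`. -/
def ConcV (Ω : Set (Euc d)) (m : VectorMeasure (XX d) (Euc d)) : Prop :=
  ∀ s : Set (XX d), MeasurableSet s → s ⊆ (Ioo (0:ℝ) 1 ×ˢ Ω)ᶜ → m s = 0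

/-- Integral of `φ` against a signed measure. -/
def sInt {α : Type*} [MeasurableSpace α] (σ : SignedMeasure α) (φ : α → ℝ) : ℝ :=
  (∫ x, φ x ∂σ.toJordanDecomposition.posPart) -
    ∫ x, φ x ∂σ.toJordanDecomposition.negPart

/-- Triples `(ρ, m, μ) ∈ M(X_Ω) × M(X_Ω; ℝ^d) × M(X_Ω)`. -/
abbrev Mtriple (d : ℕ) : Type :=
  SignedMeasure (XX d) × VectorMeasure (XX d) (Euc d) × SignedMeasure (XX d)

/-- `P` is the measure `dt ⊗ ρ_t` associated with the curve `η ∈ 𝒮_V`. -/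
def CurveMeasure {V : Set (Euc d)} (η : SCurve V) (P : Measure (XX d)) : Prop :=
  ∀ s : Set (XX d), MeasurableSet s →
    P s = ∫⁻ t in Ioo (0:ℝ) 1, η.toFun t {x | (t, x) ∈ s}

/-- `h'` and `γ'` are the a.e. derivatives of `h` on `(0,1)` and of `γ` on `{h>0}`. -/
def HasAEDerivs (γ : ℝ → Euc d) (h : ℝ → ℝ) (γ' : ℝ → Euc d) (h' : ℝ → ℝ) : Prop :=
  (∀ᵐ t ∂(volume.restrict (Ioo (0:ℝ) 1)), HasDerivAt h (h' t) t) ∧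
  (∀ᵐ t ∂(volume.restrict {t | t ∈ Ioo (0:ℝ) 1 ∧ 0 < h t}), HasDerivAt γ (γ' t) t)

/-- The triple `p = (ρ, m, μ)` is of characteristic form
`ρ = h dt ⊗ δ_γ`, `m = γ' ρ`, `μ = h' dt ⊗ δ_γ` with the regularity of `H_Ω`. -/
def CharRepr (Ω : Set (Euc d)) (γ : ℝ → Euc d) (h : ℝ → ℝ) (γ' : ℝ → Euc d)
    (h' : ℝ → ℝ) (p : Mtriple d) : Prop :=
  (∀ t ∈ Icc (0:ℝ) 1, 0 ≤ h t ∧ γ t ∈ Ω) ∧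
  AC2 h ∧ AC2 (fun t => Real.sqrt (h t)) ∧ AC2 (fun t => Real.sqrt (h t) • γ t) ∧
  (∀ φ : Euc d → ℝ, Continuous φ →
      ContinuousOn (fun t => h t * φ (γ t)) (Icc (0:ℝ) 1)) ∧
  HasAEDerivs γ h γ' h' ∧
  (∀ s : Set (XX d), MeasurableSet s →
      p.1 s = ∫ t in Ioo (0:ℝ) 1, Set.indicator {u : ℝ | (u, γ u) ∈ s} h t) ∧
  (∀ s : Set (XX d), MeasurableSet s →
      p.2.1 s = ∫ t in Ioo (0:ℝ) 1,
        Set.indicator {u : ℝ | (u, γ u) ∈ s} (fun u => h u • γ' u) t) ∧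
  (∀ s : Set (XX d), MeasurableSet s →
      p.2.2 s = ∫ t in Ioo (0:ℝ) 1, Set.indicator {u : ℝ | (u, γ u) ∈ s} h' t)

/-- The set `𝒞` of extremal characteristic triples. -/
def MemC (α β δ : ℝ) (Ω : Set (Euc d)) (p : Mtriple d) : Prop :=
  ∃ (γ : ℝ → Euc d) (h : ℝ → ℝ) (γ' : ℝ → Euc d) (h' : ℝ → ℝ),
    CharRepr Ω γ h γ' h' p ∧
    IsPreconnected {t | t ∈ Icc (0:ℝ) 1 ∧ 0 < h t} ∧
    JSigned α β δ p.1 p.2.1 p.2.2 = 1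


/-- Curves in `C_w([0,1]; M(Ω))`: narrowly continuous curves of signed measures
concentrated on `Ω`, extended to `ℝ` by clamping. -/
def IsCwCurve (Ω : Set (Euc d)) (f : ℝ → SignedMeasure (Euc d)) : Prop :=
  (∀ t, f t = f (clamp t)) ∧
  (∀ t, ∀ s : Set (Euc d), MeasurableSet s → s ⊆ Ωᶜ → f t s = 0) ∧
  (∀ φ : Euc d → ℝ, Continuous φ → Continuous fun t => sInt (f t) φ)

/-- `r` is a density with respect to `lam` of the measure `dt ⊗ f_t` on `X`. -/
def CwDensity (f : ℝ → SignedMeasure (Euc d)) (lam : Measure (XX d))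
    (r : XX d → ℝ) : Prop :=
  ∀ s : Set (XX d), MeasurableSet s →
    (∫ t in Ioo (0:ℝ) 1,
        sInt (f t) ({x : Euc d | (t, x) ∈ s}.indicator fun _ => (1:ℝ)))
      = ∫ x in s, r x ∂lam

/-- `(f, m, μ)` is a measure solution of `∂ₜ ρ + div m = μ`, `f` a curve. -/
def SolvesCECw (f : ℝ → SignedMeasure (Euc d)) (m : VectorMeasure (XX d) (Euc d))
    (μ : SignedMeasure (XX d)) : Prop :=
  ∀ (lam : Measure (XX d)), IsFiniteMeasure lam →
    ∀ (w : XX d → Euc d) (u : XX d → ℝ), Measurable w → Measurable u →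
      IsDensityV m lam w → IsDensityS μ lam u →
      ∀ φ : XX d → ℝ, IsTest φ →
        ((∫ t in Ioo (0:ℝ) 1, sInt (f t) fun x => fderiv ℝ φ (t, x) ((1:ℝ), (0 : Euc d)))
          + (∫ x, fderiv ℝ φ x ((0:ℝ), w x) ∂lam) + ∫ x, φ x * u x ∂lam) = 0

/-- `B_δ(dt ⊗ f_t, m, μ)`. -/
def BdeltaCw (δ : ℝ) (f : ℝ → SignedMeasure (Euc d)) (m : VectorMeasure (XX d) (Euc d))
    (μ : SignedMeasure (XX d)) : ℝ≥0∞ :=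
  sInf {c : ℝ≥0∞ | ∃ lam : Measure (XX d), IsFiniteMeasure lam ∧
    ∃ (r : XX d → ℝ) (w : XX d → Euc d) (u : XX d → ℝ),
      Measurable r ∧ Measurable w ∧ Measurable u ∧
      CwDensity f lam r ∧ IsDensityV m lam w ∧ IsDensityS μ lam u ∧
      c = ∫⁻ x, Psi δ (r x) (w x) (u x) ∂lam}

/-- `‖dt ⊗ f_t‖_{M(X_Ω)}`. -/
def TVCw (f : ℝ → SignedMeasure (Euc d)) : ℝ≥0∞ :=
  ∫⁻ t in Ioo (0:ℝ) 1, (f t).totalVariation Set.univ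

open Classical in
/-- `J_{α,β,δ}(dt ⊗ f_t, m, μ)`. -/
def JCw (α β δ : ℝ) (f : ℝ → SignedMeasure (Euc d)) (m : VectorMeasure (XX d) (Euc d))
    (μ : SignedMeasure (XX d)) : ℝ≥0∞ :=
  if SolvesCECw f m μ then
    ENNReal.ofReal β * BdeltaCw δ f m μ + ENNReal.ofReal α * TVCw f
  else ⊤

/-- The set `𝒞` in curve form: `(f, m, μ)` with `f_t = h(t) δ_{γ(t)}`,
`m = h γ' dt ⊗ δ_γ`, `μ = h' dt ⊗ δ_γ`, with `H_Ω`-regularity, connected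
positivity set and unit energy. -/
def MemCCw (α β δ : ℝ) (Ω : Set (Euc d)) (f : ℝ → SignedMeasure (Euc d))
    (m : VectorMeasure (XX d) (Euc d)) (μ : SignedMeasure (XX d)) : Prop :=
  ∃ (γ : ℝ → Euc d) (h : ℝ → ℝ) (γ' : ℝ → Euc d) (h' : ℝ → ℝ),
    (∀ t ∈ Icc (0:ℝ) 1, 0 ≤ h t ∧ γ t ∈ Ω) ∧
    AC2 h ∧ AC2 (fun t => Real.sqrt (h t)) ∧ AC2 (fun t => Real.sqrt (h t) • γ t) ∧
    (∀ φ : Euc d → ℝ, Continuous φ →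
        ContinuousOn (fun t => h t * φ (γ t)) (Icc (0:ℝ) 1)) ∧
    HasAEDerivs γ h γ' h' ∧
    (∀ t, f t = h (clamp t) • (Measure.dirac (γ (clamp t))).toSignedMeasure) ∧
    (∀ s : Set (XX d), MeasurableSet s →
        m s = ∫ t in Ioo (0:ℝ) 1,
          Set.indicator {u : ℝ | (u, γ u) ∈ s} (fun u => h u • γ' u) t) ∧
    (∀ s : Set (XX d), MeasurableSet s →
        μ s = ∫ t in Ioo (0:ℝ) 1, Set.indicator {u : ℝ | (u, γ u) ∈ s} h' t) ∧
    IsPreconnected {t | t ∈ Icc (0:ℝ) 1 ∧ 0 < h t} ∧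
    JCw α β δ f m μ = 1

/-- The mollified density `ρ_t ∗ ξ_ε + ε χ_V`. -/
def mollDens (V : Set (Euc d)) (ρ : ℝ → Measure (Euc d)) (ξ : Euc d → ℝ) (ε : ℝ)
    (t : ℝ) (x : Euc d) : ℝ :=
  (∫ y, (ε ^ d)⁻¹ * ξ (ε⁻¹ • (x - y)) ∂(ρ t)) + ε * V.indicator (fun _ => (1:ℝ)) x

/-- The mollified measure `ρ_t^ε = (ρ_t ∗ ξ_ε + ε χ_V) dx`. -/
def mollRho (V : Set (Euc d)) (ρ : ℝ → Measure (Euc d)) (ξ : Euc d → ℝ) (ε : ℝ) :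
    ℝ → Measure (Euc d) :=
  fun t => volume.withDensity fun x => ENNReal.ofReal (mollDens V ρ ξ ε t x)

open Classical in
/-- The mollified velocity field `v^ε = ((v ρ_t) ∗ ξ_ε) / ρ_t^ε`. -/
def mollV (V : Set (Euc d)) (ρ : ℝ → Measure (Euc d)) (v : XX d → Euc d)
    (ξ : Euc d → ℝ) (ε : ℝ) : XX d → Euc d :=
  fun p => if mollDens V ρ ξ ε p.1 p.2 = 0 then 0 else
    (mollDens V ρ ξ ε p.1 p.2)⁻¹ •
      ∫ y, ((ε ^ d)⁻¹ * ξ (ε⁻¹ • (p.2 - y))) • v (p.1, y) ∂(ρ p.1)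

open Classical in
/-- The mollified growth field `g^ε = ((g ρ_t) ∗ ξ_ε) / ρ_t^ε`. -/
def mollG (V : Set (Euc d)) (ρ : ℝ → Measure (Euc d)) (g : XX d → ℝ)
    (ξ : Euc d → ℝ) (ε : ℝ) : XX d → ℝ :=
  fun p => if mollDens V ρ ξ ε p.1 p.2 = 0 then 0 else
    (mollDens V ρ ξ ε p.1 p.2)⁻¹ *
      ∫ y, ((ε ^ d)⁻¹ * ξ (ε⁻¹ • (p.2 - y))) * g (p.1, y) ∂(ρ p.1)


/-! ### Part 1: Caratheodory fields and their flow -/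

/-- Caratheodory fields: bounded and Lipschitz in space with constant `C t`. -/
structure Car {F : Type*} [NormedAddCommGroup F] [MeasurableSpace F] (C : ℝ → ℝ)
    (u : ℝ × Euc d → F) : Prop where
  meas : Measurable u
  bdd : ∀ t x, ‖u (t, x)‖ ≤ C t
  lip : ∀ t x y, ‖u (t, x) - u (t, y)‖ ≤ C t * ‖x - y‖

/-- The primitive of `C`. -/
def LL (C : ℝ → ℝ) (t : ℝ) : ℝ := ∫ r in (0:ℝ)..t, C r

section LLsec
variable {C : ℝ → ℝ} (hC : Integrable C) (h0 : ∀ t, 0 ≤ C t)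

include hC in
lemma LL_cont : Continuous (LL C) := by
  unfold LL
  exact intervalIntegral.continuous_primitive (fun a b => hC.intervalIntegrable) 0

include hC in
lemma LL_sub (s t : ℝ) : ∫ r in s..t, C r = LL C t - LL C s := by
  unfold LL
  rw [intervalIntegral.integral_interval_sub_left hC.intervalIntegrable hC.intervalIntegrable]

include hC h0 in
lemma LL_mono : Monotone (LL C) := by
  intro s t hst
  have := LL_sub hC s t
  have h : 0 ≤ ∫ r in s..t, C r := intervalIntegral.integral_nonneg hst (fun r _ => h0 r)
  linarith

include hC h0 in
lemma LL_le (s t : ℝ) : LL C t - LL C s ≤ ∫ r, C r := by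
  rcases le_total s t with hst | hst
  · rw [← LL_sub hC, intervalIntegral.integral_of_le hst]
    exact setIntegral_le_integral hC (Eventually.of_forall h0)
  · have := LL_mono hC h0 hst
    have h : 0 ≤ ∫ r, C r := integral_nonneg h0
    linarith

include hC h0 in
lemma weight_int (s t : ℝ) (hst : s ≤ t) :
    ∫ r in s..t, C r * Real.exp (2 * LL C r) ≤ Real.exp (2 * LL C t) / 2 := by
  set f : ℝ → ℝ := fun r => ∫ q in s..r, C q with hf
  have hfL : ∀ r, f r = LL C r - LL C s := fun r => LL_sub hC s r
  have hac : AbsolutelyContinuousOnInterval f s t :=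
    hC.intervalIntegrable.absolutelyContinuousOnInterval_intervalIntegral left_mem_uIcc
  obtain ⟨M, hM⟩ : ∃ M, ∀ r, f r ≤ M :=
    ⟨∫ r, C r, fun r => by rw [hfL]; exact LL_le hC h0 s r⟩
  have hexp : ∀ a b : ℝ, a ≤ M → b ≤ M →
      dist (Real.exp (2 * a)) (Real.exp (2 * b)) ≤ (2 * Real.exp (2 * M)) * dist a b := by
    have key : ∀ a b : ℝ, a ≤ b → b ≤ M →
        Real.exp (2 * b) - Real.exp (2 * a) ≤ (2 * Real.exp (2 * M)) * (b - a) := by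
      intro a b hab hb
      have h1 : Real.exp (2 * a) = Real.exp (2 * b) * Real.exp (2 * a - 2 * b) := by
        rw [← Real.exp_add]; congr 1; ring
      have h2 := Real.add_one_le_exp (2 * a - 2 * b)
      have h3 : Real.exp (2 * b) ≤ Real.exp (2 * M) := Real.exp_le_exp.2 (by linarith)
      have h4 := Real.exp_pos (2 * b)
      rw [h1]
      nlinarith
    intro a b ha hb
    rw [Real.dist_eq, Real.dist_eq]
    rcases le_total a b with h | h
    · rw [abs_sub_comm, abs_sub_comm a, abs_of_nonneg, abs_of_nonneg]
      · exact key a b h hb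
      · linarith
      · have := Real.exp_le_exp.2 (show 2 * a ≤ 2 * b by linarith); linarith
    · rw [abs_of_nonneg, abs_of_nonneg]
      · exact key b a h ha
      · linarith
      · have := Real.exp_le_exp.2 (show 2 * b ≤ 2 * a by linarith); linarith
  have hac2 : AbsolutelyContinuousOnInterval (fun r => Real.exp (2 * f r)) s t := by
    unfold AbsolutelyContinuousOnInterval at hac ⊢
    refine squeeze_zero (fun E => Finset.sum_nonneg fun _ _ => dist_nonneg) (fun E => ?_)
      (by simpa using hac.const_mul (2 * Real.exp (2 * M)))
    rw [Finset.mul_sum]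
    exact Finset.sum_le_sum fun i _ => hexp _ _ (hM _) (hM _)
  have h1 := hac2.integral_deriv_eq_sub
  have h2 : ∫ r in s..t, deriv (fun r => Real.exp (2 * f r)) r
      = ∫ r in s..t, 2 * (C r * Real.exp (2 * f r)) := by
    apply intervalIntegral.integral_congr_ae
    filter_upwards [(hC.intervalIntegrable (a := s) (b := t)).ae_hasDerivAt_integral] with r hr hrm
    have := hr (uIoc_subset_uIcc hrm) s left_mem_uIcc
    have h3 : HasDerivAt (fun r => Real.exp (2 * f r)) (Real.exp (2 * f r) * (2 * C r)) r :=
      (this.const_mul 2).exp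
    rw [h3.deriv]; ring
  rw [h2, intervalIntegral.integral_const_mul] at h1
  have h4 : f s = 0 := by simp [hf]
  have h5 : ∫ r in s..t, C r * Real.exp (2 * LL C r)
      = Real.exp (2 * LL C s) * ∫ r in s..t, C r * Real.exp (2 * f r) := by
    rw [← intervalIntegral.integral_const_mul]
    congr 1; ext r
    rw [hfL, show 2 * LL C r = 2 * LL C s + 2 * (LL C r - LL C s) by ring, Real.exp_add]; ring_nf
  have h6 : Real.exp (2 * LL C t) = Real.exp (2 * LL C s) * Real.exp (2 * f t) := by
    rw [← Real.exp_add, hfL]; ring_nf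
  rw [h5, h6]
  have h7 : ∫ r in s..t, C r * Real.exp (2 * f r) ≤ Real.exp (2 * f t) / 2 := by
    rw [h4] at h1; simp at h1; linarith
  have := mul_le_mul_of_nonneg_left h7 (Real.exp_pos (2 * LL C s)).le
  linarith

include hC h0 in
/-- Gronwall inequality with an integrable kernel. -/
lemma gron (u : ℝ → ℝ) (hu : Continuous u) (hu0 : ∀ t, 0 ≤ u t) (a s T : ℝ)
    (h : ∀ t ∈ Icc s T, u t ≤ a + ∫ r in s..t, C r * u r) :
    ∀ t ∈ Icc s T, u t ≤ 2 * Real.exp (2 * ∫ r, C r) * a := by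
  intro t ht
  have hcont : Continuous fun r => Real.exp (-(2 * LL C r)) * u r := by
    have := LL_cont hC
    fun_prop
  obtain ⟨t0, ht0, hmax⟩ := (isCompact_Icc (a := s) (b := T)).exists_isMaxOn ⟨t, ht⟩
    hcont.continuousOn
  have hmax' : ∀ r ∈ Icc s T, u r ≤
      Real.exp (2 * LL C r) * (Real.exp (-(2 * LL C t0)) * u t0) := by
    intro r hr
    have h1 : Real.exp (-(2 * LL C r)) * u r ≤ Real.exp (-(2 * LL C t0)) * u t0 := hmax hr
    calc u r = Real.exp (2 * LL C r) * (Real.exp (-(2 * LL C r)) * u r) := by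
          rw [← mul_assoc, ← Real.exp_add]; simp
      _ ≤ _ := mul_le_mul_of_nonneg_left h1 (Real.exp_pos _).le
  set m := Real.exp (-(2 * LL C t0)) * u t0 with hm
  have hm0 : 0 ≤ m := mul_nonneg (Real.exp_pos _).le (hu0 _)
  have hLc := LL_cont hC
  have hii : ∀ w : ℝ → ℝ, Continuous w → IntervalIntegrable (fun r => C r * w r) volume s t0 :=
    fun w hw => (hC.intervalIntegrable).mul_continuousOn hw.continuousOn
  have h2 : ∫ r in s..t0, C r * u r ≤ ∫ r in s..t0, (C r * Real.exp (2 * LL C r)) * m := by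
    apply intervalIntegral.integral_mono_on ht0.1 (hii u hu)
    · exact (hii (fun r => Real.exp (2 * LL C r)) (by fun_prop)).mul_const m
    · intro r hr
      have := mul_le_mul_of_nonneg_left (hmax' r ⟨hr.1, hr.2.trans ht0.2⟩) (h0 r)
      linarith
  rw [intervalIntegral.integral_mul_const] at h2
  have h3 := mul_le_mul_of_nonneg_right (weight_int hC h0 s t0 ht0.1) hm0
  have h4 : Real.exp (2 * LL C t0) * m = u t0 := by
    rw [hm, ← mul_assoc, ← Real.exp_add]; simp
  have h5 := h t0 ht0
  have h6 : u t0 ≤ 2 * a := by linarith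
  have h7 : u t ≤ Real.exp (2 * (LL C t - LL C t0)) * u t0 := by
    refine (hmax' t ht).trans_eq ?_
    rw [hm, ← mul_assoc, ← Real.exp_add]; ring_nf
  have h8 : Real.exp (2 * (LL C t - LL C t0)) ≤ Real.exp (2 * ∫ r, C r) :=
    Real.exp_le_exp.2 (by have := LL_le hC h0 t0 t; linarith)
  calc u t ≤ _ := h7
    _ ≤ Real.exp (2 * ∫ r, C r) * (2 * a) :=
      mul_le_mul h8 h6 (hu0 _) (Real.exp_pos _).le
    _ = _ := by ring
end LLsec

section Carsec
variable {C : ℝ → ℝ} (hC : Integrable C)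
variable {F : Type*} [NormedAddCommGroup F] [MeasurableSpace F] [BorelSpace F]
  [SecondCountableTopology F]

lemma Car.nonneg {u : ℝ × Euc d → F} (hu : Car C u) (t : ℝ) : 0 ≤ C t :=
  (norm_nonneg _).trans (hu.bdd t 0)

include hC in
lemma Car.integrable {u : ℝ × Euc d → F} (hu : Car C u) {Y : ℝ → Euc d} (hY : Measurable Y) :
    Integrable (fun r => u (r, Y r)) := by
  refine hC.mono' ?_ (Eventually.of_forall fun r => hu.bdd r _)
  exact (hu.meas.comp (measurable_id.prodMk hY)).aestronglyMeasurable

variable [NormedSpace ℝ F]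

include hC in
/-- difference of integrals along two curves -/
lemma Car.diff {u : ℝ × Euc d → F} (hu : Car C u) {Y Z : ℝ → Euc d} (hY : Continuous Y)
    (hZ : Continuous Z) {s t : ℝ} (hst : s ≤ t) :
    ‖(∫ r in s..t, u (r, Y r)) - ∫ r in s..t, u (r, Z r)‖ ≤ ∫ r in s..t, C r * ‖Y r - Z r‖ := by
  rw [← intervalIntegral.integral_sub (hu.integrable hC hY.measurable).intervalIntegrable
    (hu.integrable hC hZ.measurable).intervalIntegrable]
  refine intervalIntegral.norm_integral_le_of_norm_le hst
    (Eventually.of_forall fun r _ => hu.lip r _ _) ?_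
  exact hC.intervalIntegrable.mul_continuousOn (by fun_prop)

include hC in
lemma Car.int_le {u : ℝ × Euc d → F} (hu : Car C u) (Y : ℝ → Euc d)
    {s t : ℝ} (hst : s ≤ t) :
    ‖∫ r in s..t, u (r, Y r)‖ ≤ LL C t - LL C s := by
  rw [← LL_sub hC]
  exact intervalIntegral.norm_integral_le_of_norm_le hst
    (Eventually.of_forall fun r _ => hu.bdd r _) hC.intervalIntegrable
end Carsec

section Flow
variable {C : ℝ → ℝ} (hC : Integrable C) {v : ℝ × Euc d → Euc d} (hv : Car C v)

include hC hv in
lemma exists_sol (s : ℝ) (x : Euc d) : ∃ X : ℝ → Euc d, Continuous X ∧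
    ∀ t, X t = x + ∫ r in s..max s t, v (r, X r) := by
  have h0 := hv.nonneg
  have hLc := LL_cont hC
  have hinteg : ∀ Y : ℝ → Euc d, Continuous Y → Continuous fun t => ∫ r in s..max s t, v (r, Y r) := by
    intro Y hY
    have h1 : Continuous fun t => ∫ r in s..t, v (r, Y r) :=
      intervalIntegral.continuous_primitive
        (fun a b => (hv.integrable hC hY.measurable).intervalIntegrable) s
    exact h1.comp (continuous_const.max continuous_id)
  have hlow : ∀ t, Real.exp (-(2 * LL C t)) ≤ Real.exp (2 * ∫ r, C r) := by
    intro t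
    apply Real.exp_le_exp.2
    have := LL_le hC h0 t 0
    simp only [LL, intervalIntegral.integral_same] at this ⊢
    linarith
  let Γ : (BoundedContinuousFunction ℝ (Euc d)) → ℝ → Euc d :=
    fun Y r => x + Real.exp (2 * LL C r) • Y r
  have hΓ : ∀ Y, Continuous (Γ Y) := fun Y => by
    have := Y.continuous
    simp only [Γ]; fun_prop
  let Φ : (BoundedContinuousFunction ℝ (Euc d)) → (BoundedContinuousFunction ℝ (Euc d)) := fun Y =>
    BoundedContinuousFunction.ofNormedAddCommGroup
      (fun t => Real.exp (-(2 * LL C t)) • ∫ r in s..max s t, v (r, Γ Y r))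
      (by
        have := hinteg (Γ Y) (hΓ Y)
        fun_prop)
      (Real.exp (2 * ∫ r, C r) * ∫ r, C r)
      (by
        intro t
        rw [norm_smul, Real.norm_eq_abs, abs_of_pos (Real.exp_pos _)]
        exact mul_le_mul (hlow t)
          ((hv.int_le hC _ (le_max_left _ _)).trans (LL_le hC h0 _ _)) (norm_nonneg _)
          (Real.exp_pos _).le)
  have hcontr : ContractingWith (1/2 : ℝ≥0) Φ := by
    refine ⟨by norm_num, LipschitzWith.of_dist_le_mul fun Y Z => ?_⟩
    rw [BoundedContinuousFunction.dist_le (by positivity)]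
    intro t
    have e : dist (Φ Y t) (Φ Z t) = Real.exp (-(2 * LL C t)) *
        ‖(∫ r in s..max s t, v (r, Γ Y r)) - ∫ r in s..max s t, v (r, Γ Z r)‖ := by
      simp only [Φ, BoundedContinuousFunction.coe_ofNormedAddCommGroup]
      rw [dist_eq_norm, ← smul_sub, norm_smul, Real.norm_eq_abs, abs_of_pos (Real.exp_pos _)]
    rw [e]
    have h1 := hv.diff hC (hΓ Y) (hΓ Z) (le_max_left s t)
    have h2 : ∫ r in s..max s t, C r * ‖Γ Y r - Γ Z r‖
        ≤ ∫ r in s..max s t, (C r * Real.exp (2 * LL C r)) * dist Y Z := by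
      have hY := hΓ Y
      have hZ := hΓ Z
      apply intervalIntegral.integral_mono_on (le_max_left _ _)
      · exact hC.intervalIntegrable.mul_continuousOn (by fun_prop)
      · exact (hC.intervalIntegrable.mul_continuousOn
          (g := fun r => Real.exp (2 * LL C r)) (by fun_prop)).mul_const _
      · intro r _
        have : ‖Γ Y r - Γ Z r‖ ≤ Real.exp (2 * LL C r) * dist Y Z := by
          simp only [Γ]
          rw [add_sub_add_left_eq_sub, ← smul_sub, norm_smul, Real.norm_eq_abs,
            abs_of_pos (Real.exp_pos _), ← dist_eq_norm]
          exact mul_le_mul_of_nonneg_left (BoundedContinuousFunction.dist_coe_le_dist r)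
            (Real.exp_pos _).le
        rw [mul_assoc]
        exact mul_le_mul_of_nonneg_left this (h0 r)
    rw [intervalIntegral.integral_mul_const] at h2
    have h3 := mul_le_mul_of_nonneg_right (weight_int hC h0 s (max s t) (le_max_left _ _))
      (dist_nonneg (x := Y) (y := Z))
    have h4 := (h1.trans h2).trans h3
    by_cases hts : s ≤ t
    · rw [max_eq_right hts] at h4 ⊢
      have h5 := mul_le_mul_of_nonneg_left h4 (Real.exp_pos (-(2 * LL C t))).le
      refine h5.trans_eq ?_
      have : Real.exp (-(2 * LL C t)) * Real.exp (2 * LL C t) = 1 := by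
        rw [← Real.exp_add]; simp
      calc _ = (Real.exp (-(2 * LL C t)) * Real.exp (2 * LL C t)) / 2 * dist Y Z := by ring
        _ = _ := by rw [this]; simp
    · rw [max_eq_left (not_le.1 hts).le]
      simp
  have hfix : Φ (hcontr.fixedPoint) = hcontr.fixedPoint := hcontr.fixedPoint_isFixedPt
  refine ⟨Γ hcontr.fixedPoint, hΓ _, fun t => ?_⟩
  conv_lhs => 
    simp only [Γ]
    rw [← hfix]
  simp only [Φ, BoundedContinuousFunction.coe_ofNormedAddCommGroup]
  rw [smul_smul, ← Real.exp_add]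
  simp

/-- The flow of a Caratheodory field. -/
def flow (hC : Integrable C) (hv : Car C v) (s : ℝ) (x : Euc d) : ℝ → Euc d :=
  (exists_sol hC hv s x).choose

lemma flow_cont (s : ℝ) (x : Euc d) : Continuous (flow hC hv s x) :=
  (exists_sol hC hv s x).choose_spec.1

lemma flow_eq' (s : ℝ) (x : Euc d) (t : ℝ) :
    flow hC hv s x t = x + ∫ r in s..max s t, v (r, flow hC hv s x r) :=
  (exists_sol hC hv s x).choose_spec.2 t

lemma flow_eq (s : ℝ) (x : Euc d) {t : ℝ} (hst : s ≤ t) :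
    flow hC hv s x t = x + ∫ r in s..t, v (r, flow hC hv s x r) := by
  rw [flow_eq', max_eq_right hst]

lemma flow_self (s : ℝ) (x : Euc d) : flow hC hv s x s = x := by
  rw [flow_eq hC hv s x le_rfl]; simp

lemma flow_sub_le (s : ℝ) (x : Euc d) {t : ℝ} (hst : s ≤ t) :
    ‖flow hC hv s x t - x‖ ≤ LL C t - LL C s := by
  rw [flow_eq hC hv s x hst, add_sub_cancel_left]
  exact hv.int_le hC _ hst

/-- Two solutions stay close. -/
lemma sol_close {Y Z : ℝ → Euc d} (hY : Continuous Y) (hZ : Continuous Z) {s T : ℝ} (x y : Euc d)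
    (eY : ∀ t ∈ Icc s T, Y t = x + ∫ r in s..t, v (r, Y r))
    (eZ : ∀ t ∈ Icc s T, Z t = y + ∫ r in s..t, v (r, Z r)) (hC : Integrable C) (hv : Car C v) :
    ∀ t ∈ Icc s T, ‖Y t - Z t‖ ≤ 2 * Real.exp (2 * ∫ r, C r) * ‖x - y‖ := by
  apply gron hC hv.nonneg (fun t => ‖Y t - Z t‖) (by fun_prop) (fun t => norm_nonneg _)
  intro t ht
  have e : Y t - Z t = (x - y) + ((∫ r in s..t, v (r, Y r)) - ∫ r in s..t, v (r, Z r)) := by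
    rw [eY t ht, eZ t ht]; abel
  rw [e]
  exact (norm_add_le _ _).trans (add_le_add le_rfl (hv.diff hC hY hZ ht.1))

lemma flow_lip (s : ℝ) (x y : Euc d) {t : ℝ} (hst : s ≤ t) :
    ‖flow hC hv s x t - flow hC hv s y t‖ ≤ 2 * Real.exp (2 * ∫ r, C r) * ‖x - y‖ :=
  sol_close (flow_cont hC hv s x) (flow_cont hC hv s y) x y
    (fun _ h => flow_eq hC hv s x h.1) (fun _ h => flow_eq hC hv s y h.1) hC hv t ⟨hst, le_rfl⟩

lemma flow_semi (x : Euc d) {s t T : ℝ} (hst : s ≤ t) (htT : t ≤ T) :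
    flow hC hv s x T = flow hC hv t (flow hC hv s x t) T := by
  have := sol_close (flow_cont hC hv s x) (flow_cont hC hv t (flow hC hv s x t))
    (flow hC hv s x t) (flow hC hv s x t) (s := t) (T := T) ?_
    (fun _ h => flow_eq hC hv t _ h.1) hC hv T ⟨htT, le_rfl⟩
  · rw [sub_self, norm_zero, mul_zero] at this
    exact sub_eq_zero.1 (norm_le_zero_iff.1 this)
  · intro q hq
    rw [flow_eq hC hv s x (hst.trans hq.1), flow_eq hC hv s x hst, add_assoc]
    have hi := hv.integrable hC (flow_cont hC hv s x).measurable
    rw [intervalIntegral.integral_add_adjacent_intervals hi.intervalIntegrable hi.intervalIntegrable]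

lemma flow_joint (s : ℝ) : Continuous fun p : Euc d × ℝ => flow hC hv s p.1 p.2 := by
  refine continuous_prod_of_continuous_lipschitzWith _
    (Real.toNNReal (2 * Real.exp (2 * ∫ r, C r)) + 1) (fun x => flow_cont hC hv s x) ?_
  intro t
  refine LipschitzWith.of_dist_le_mul fun x y => ?_
  rw [dist_eq_norm, dist_eq_norm]
  have hp : (0:ℝ) ≤ 2 * Real.exp (2 * ∫ r, C r) := by positivity
  rw [NNReal.coe_add, Real.coe_toNNReal _ hp, NNReal.coe_one]
  rcases le_total s t with h | h
  · have := flow_lip hC hv s x y h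
    nlinarith [norm_nonneg (x - y)]
  · rw [flow_eq', flow_eq', max_eq_left h]
    simp only [intervalIntegral.integral_same, add_zero]
    nlinarith [norm_nonneg (x - y)]

end Flow

/-- Bounded Lipschitz functions with support in a ball. -/
structure Tst (M R : ℝ) (w : Euc d → ℝ) : Prop where
  bdd : ∀ x, |w x| ≤ M
  lip : ∀ x y, |w x - w y| ≤ M * ‖x - y‖
  supp : ∀ x, R < ‖x‖ → w x = 0

lemma Tst.nonneg {M R : ℝ} {w : Euc d → ℝ} (h : Tst M R w) : 0 ≤ M :=
  (abs_nonneg _).trans (h.bdd 0)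

lemma Tst.cont {M R : ℝ} {w : Euc d → ℝ} (h : Tst M R w) : Continuous w := by
  have : LipschitzWith (Real.toNNReal M) w := LipschitzWith.of_dist_le_mul fun x y => by
    rw [Real.coe_toNNReal _ h.nonneg, dist_eq_norm, dist_eq_norm]
    exact h.lip x y
  exact this.continuous

lemma exp_lip {K a b : ℝ} (ha : a ≤ K) (hb : b ≤ K) :
    |Real.exp a - Real.exp b| ≤ Real.exp K * |a - b| := by
  have key : ∀ a b : ℝ, a ≤ b → b ≤ K →
      Real.exp b - Real.exp a ≤ Real.exp K * (b - a) := by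
    intro a b hab hb
    have h1 : Real.exp a = Real.exp b * Real.exp (a - b) := by
      rw [← Real.exp_add]; congr 1; ring
    have h2 := Real.add_one_le_exp (a - b)
    have h3 : Real.exp b ≤ Real.exp K := Real.exp_le_exp.2 hb
    have h4 := Real.exp_pos b
    rw [h1]
    nlinarith
  rcases le_total a b with h | h
  · rw [abs_sub_comm, abs_sub_comm a, abs_of_nonneg, abs_of_nonneg]
    · exact key a b h hb
    · linarith
    · have := Real.exp_le_exp.2 h; linarith
  · rw [abs_of_nonneg, abs_of_nonneg]
    · exact key b a h ha
    · linarith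
    · have := Real.exp_le_exp.2 h; linarith

lemma exp_taylor {K a : ℝ} (hK : 0 ≤ K) (ha : |a| ≤ K) :
    |Real.exp a - 1 - a| ≤ Real.exp K * a ^ 2 := by
  have h1 := Real.add_one_le_exp a
  have h2 := Real.add_one_le_exp (-a)
  have h3 : Real.exp a * Real.exp (-a) = 1 := by rw [← Real.exp_add]; simp
  have h4 := Real.exp_pos a
  have h5 := exp_lip (K := K) (a := a) (b := 0) ((le_abs_self a).trans ha) hK
  rw [Real.exp_zero, sub_zero] at h5
  rw [abs_of_nonneg (by linarith)]
  have h6 : Real.exp a - 1 - a ≤ a * (Real.exp a - 1) := by nlinarith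
  calc _ ≤ _ := h6
    _ ≤ |a * (Real.exp a - 1)| := le_abs_self _
    _ = |a| * |Real.exp a - 1| := abs_mul _ _
    _ ≤ |a| * (Real.exp K * |a|) := mul_le_mul_of_nonneg_left h5 (abs_nonneg _)
    _ = Real.exp K * |a| ^ 2 := by ring
    _ = _ := by rw [sq_abs]

section Dual
variable {C : ℝ → ℝ} (hC : Integrable C) {v : ℝ × Euc d → Euc d} (hv : Car C v)
  {g : ℝ × Euc d → ℝ} (hg : Car C g)

/-- The backward dual solution. -/
def dual (hC : Integrable C) (hv : Car C v) (g : ℝ × Euc d → ℝ) (φ : Euc d → ℝ) (T s : ℝ)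
    (x : Euc d) : ℝ :=
  φ (flow hC hv s x T) * Real.exp (∫ r in s..T, g (r, flow hC hv s x r))

include hg in
lemma dual_tst {φ : Euc d → ℝ} {M R : ℝ} (hφ : Tst M R φ) (T : ℝ) :
    ∃ M' R', ∀ s ≤ T, Tst M' R' (dual hC hv g φ T s) := by
  set Λ := ∫ r, C r with hΛ
  have h0 := hv.nonneg
  have hΛ0 : 0 ≤ Λ := integral_nonneg h0
  set K := 2 * Real.exp (2 * Λ) with hK
  have hK0 : 0 ≤ K := by positivity
  have hM := hφ.nonneg
  have hE := Real.exp_pos Λ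
  have hJ : ∀ s ≤ T, ∀ x, |∫ r in s..T, g (r, flow hC hv s x r)| ≤ Λ := fun s hs x =>
    (hg.int_le hC _ hs).trans (LL_le hC h0 _ _)
  have hJe : ∀ s ≤ T, ∀ x, Real.exp (∫ r in s..T, g (r, flow hC hv s x r)) ≤ Real.exp Λ :=
    fun s hs x => Real.exp_le_exp.2 ((le_abs_self _).trans (hJ s hs x))
  refine ⟨M * Real.exp Λ * (1 + K + Λ * K), R + Λ, fun s hs => ⟨fun x => ?_, fun x y => ?_,
    fun x hx => ?_⟩⟩
  · rw [dual, abs_mul, abs_of_pos (Real.exp_pos _)]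
    calc _ ≤ M * Real.exp Λ := mul_le_mul (hφ.bdd _) (hJe s hs x) (Real.exp_pos _).le hM
      _ ≤ _ := le_mul_of_one_le_right (by positivity) (by nlinarith [mul_nonneg hΛ0 hK0])
  · have hX := flow_lip hC hv s x y hs
    rw [← hΛ, ← hK] at hX
    have hJ2 : |(∫ r in s..T, g (r, flow hC hv s x r)) - ∫ r in s..T, g (r, flow hC hv s y r)|
        ≤ Λ * (K * ‖x - y‖) := by
      refine (hg.diff hC (flow_cont hC hv s x) (flow_cont hC hv s y) hs).trans ?_
      calc ∫ r in s..T, C r * ‖flow hC hv s x r - flow hC hv s y r‖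
          ≤ ∫ r in s..T, C r * (K * ‖x - y‖) := by
            have h1 := flow_cont hC hv s x
            have h2 := flow_cont hC hv s y
            apply intervalIntegral.integral_mono_on hs
            · exact hC.intervalIntegrable.mul_continuousOn (by fun_prop)
            · exact hC.intervalIntegrable.mul_const _
            · intro r hr
              exact mul_le_mul_of_nonneg_left (flow_lip hC hv s x y hr.1) (h0 r)
        _ = (LL C T - LL C s) * (K * ‖x - y‖) := by
            rw [intervalIntegral.integral_mul_const, LL_sub hC]
        _ ≤ _ := mul_le_mul_of_nonneg_right (LL_le hC h0 _ _) (by positivity)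
    have e1 := exp_lip ((le_abs_self _).trans (hJ s hs x)) ((le_abs_self _).trans (hJ s hs y))
    have hx' := hJe s hs x
    simp only [dual]
    set jx := ∫ r in s..T, g (r, flow hC hv s x r)
    set jy := ∫ r in s..T, g (r, flow hC hv s y r)
    have e2 := hφ.lip (flow hC hv s x T) (flow hC hv s y T)
    set px := flow hC hv s x T
    set py := flow hC hv s y T
    have e3 : φ px * Real.exp jx - φ py * Real.exp jy
        = (φ px - φ py) * Real.exp jx + φ py * (Real.exp jx - Real.exp jy) := by ring
    have e4 : |φ px - φ py| * Real.exp jx ≤ M * (K * ‖x - y‖) * Real.exp Λ :=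
      mul_le_mul (e2.trans (mul_le_mul_of_nonneg_left hX hM)) hx' (Real.exp_pos _).le (by positivity)
    have e5 : |φ py| * |Real.exp jx - Real.exp jy| ≤ M * (Real.exp Λ * (Λ * (K * ‖x - y‖))) :=
      mul_le_mul (hφ.bdd _) (e1.trans (mul_le_mul_of_nonneg_left hJ2 hE.le)) (abs_nonneg _) hM
    rw [e3]
    calc _ ≤ |φ px - φ py| * Real.exp jx + |φ py| * |Real.exp jx - Real.exp jy| := by
          refine (abs_add_le _ _).trans ?_
          rw [abs_mul, abs_mul, abs_of_pos (Real.exp_pos jx)]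
      _ ≤ M * (K * ‖x - y‖) * Real.exp Λ + M * (Real.exp Λ * (Λ * (K * ‖x - y‖))) :=
          add_le_add e4 e5
      _ = M * Real.exp Λ * (K + Λ * K) * ‖x - y‖ := by ring
      _ ≤ _ := by
          apply mul_le_mul_of_nonneg_right _ (norm_nonneg _)
          apply mul_le_mul_of_nonneg_left _ (by positivity)
          linarith
  · have h1 := flow_sub_le hC hv s x hs
    have h2 := LL_le hC h0 s T
    have h3 : ‖x‖ ≤ ‖flow hC hv s x T‖ + ‖flow hC hv s x T - x‖ := by
      rw [norm_sub_rev]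
      calc ‖x‖ = ‖flow hC hv s x T + (x - flow hC hv s x T)‖ := by congr 1; abel
        _ ≤ _ := norm_add_le _ _
    rw [dual, hφ.supp _ (by linarith), zero_mul]

include hg in
lemma dual_semi (φ : Euc d → ℝ) (x : Euc d) {s t T : ℝ} (hst : s ≤ t) (htT : t ≤ T) :
    dual hC hv g φ T s x = dual hC hv g φ T t (flow hC hv s x t) *
      Real.exp (∫ r in s..t, g (r, flow hC hv s x r)) := by
  simp only [dual]
  rw [flow_semi hC hv x hst htT, mul_assoc, ← Real.exp_add]
  congr 2
  have hi := hg.integrable hC (flow_cont hC hv s x).measurable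
  rw [← intervalIntegral.integral_add_adjacent_intervals (b := t) hi.intervalIntegrable
    hi.intervalIntegrable, add_comm]
  congr 1
  apply intervalIntegral.integral_congr
  intro r hr
  rw [uIcc_of_le htT] at hr
  simp only
  rw [flow_semi hC hv x hst hr.1]

lemma car_freeze {F : Type*} [NormedAddCommGroup F] [MeasurableSpace F] [BorelSpace F]
    [SecondCountableTopology F] [NormedSpace ℝ F] {u : ℝ × Euc d → F} (hu : Car C u)
    (x : Euc d) {s t : ℝ} (hst : s ≤ t) :
    ‖(∫ r in s..t, u (r, flow hC hv s x r)) - ∫ r in s..t, u (r, x)‖ ≤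
      (LL C t - LL C s) ^ 2 := by
  have h1 := flow_cont hC hv s x
  refine (hu.diff hC h1 (continuous_const (y := x)) hst).trans ?_
  calc ∫ r in s..t, C r * ‖flow hC hv s x r - x‖
      ≤ ∫ r in s..t, C r * (LL C t - LL C s) := by
        apply intervalIntegral.integral_mono_on hst
        · exact hC.intervalIntegrable.mul_continuousOn (by fun_prop)
        · exact hC.intervalIntegrable.mul_const _
        · intro r hr
          refine mul_le_mul_of_nonneg_left ?_ (hv.nonneg r)
          have := LL_mono hC hv.nonneg hr.2
          have := flow_sub_le hC hv s x hr.1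
          linarith
    _ = _ := by rw [intervalIntegral.integral_mul_const, LL_sub hC]; ring

include hg in
lemma local_est {w : Euc d → ℝ} {M R : ℝ} (hw : Tst M R w) (x : Euc d) {s t : ℝ} (hst : s ≤ t) :
    |w (flow hC hv s x t) * Real.exp (∫ r in s..t, g (r, flow hC hv s x r))
      - (w (x + ∫ r in s..t, v (r, x)) + (∫ r in s..t, g (r, x)) * w x)|
      ≤ M * (3 + Real.exp (∫ r, C r)) * (LL C t - LL C s) ^ 2 := by
  set Λ := ∫ r, C r with hΛ
  have h0 := hv.nonneg
  have hΛ0 : 0 ≤ Λ := integral_nonneg h0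
  have hM := hw.nonneg
  have f1 := car_freeze hC hv hv x hst
  have f2 := car_freeze hC hv hg x hst
  have f3 := hg.int_le hC (flow hC hv s x) hst
  have f4 := LL_le hC h0 s t
  have f5 := exp_taylor hΛ0 (f3.trans f4)
  have f6 := flow_sub_le hC hv s x hst
  have f7 : ‖flow hC hv s x t - (x + ∫ r in s..t, v (r, x))‖ ≤ (LL C t - LL C s) ^ 2 := by
    rw [flow_eq hC hv s x hst, add_sub_add_left_eq_sub]; exact f1
  have hω : 0 ≤ LL C t - LL C s := sub_nonneg.2 (LL_mono hC h0 hst)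
  rw [Real.norm_eq_abs] at f2 f3
  set ω := LL C t - LL C s
  set a := ∫ r in s..t, g (r, flow hC hv s x r)
  set G := ∫ r in s..t, g (r, x)
  set X := flow hC hv s x t
  set Y := x + ∫ r in s..t, v (r, x)
  have e : w X * Real.exp a - (w Y + G * w x) =
    (w X - w Y) + a * (w X - w x) + (a - G) * w x + (Real.exp a - 1 - a) * w X := by ring
  rw [e]
  have t1 : |w X - w Y| ≤ M * ω ^ 2 := (hw.lip _ _).trans (mul_le_mul_of_nonneg_left f7 hM)
  have t2 : |a * (w X - w x)| ≤ ω * (M * ω) := by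
    rw [abs_mul]
    exact mul_le_mul f3 ((hw.lip _ _).trans (mul_le_mul_of_nonneg_left f6 hM)) (abs_nonneg _) hω
  have t3 : |(a - G) * w x| ≤ ω ^ 2 * M := by
    rw [abs_mul]
    exact mul_le_mul f2 (hw.bdd _) (abs_nonneg _) (by positivity)
  have t4 : |(Real.exp a - 1 - a) * w X| ≤ (Real.exp Λ * ω ^ 2) * M := by
    rw [abs_mul]
    refine mul_le_mul (f5.trans ?_) (hw.bdd _) (abs_nonneg _) (by positivity)
    apply mul_le_mul_of_nonneg_left _ (Real.exp_pos _).le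
    rw [← sq_abs]
    exact pow_le_pow_left₀ (abs_nonneg _) f3 2
  calc _ ≤ |w X - w Y| + |a * (w X - w x)| + |(a - G) * w x| + |(Real.exp a - 1 - a) * w X| := by
        refine (abs_add_le _ _).trans (add_le_add ?_ le_rfl)
        refine (abs_add_le _ _).trans (add_le_add ?_ le_rfl)
        exact abs_add_le _ _
    _ ≤ _ := by linarith

end Dual

/-- A mollifier at scale `ε`. -/
structure Mol (ε : ℝ) (ξ : Euc d → ℝ) : Prop where
  smooth : ContDiff ℝ (⊤ : ℕ∞) ξ
  cs : HasCompactSupport ξ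
  nonneg : ∀ z, 0 ≤ ξ z
  int : ∫ z, ξ z = 1
  supp : ∀ z, ε ≤ ‖z‖ → ξ z = 0

lemma exists_mol {ε : ℝ} (hε : 0 < ε) : ∃ ξ : Euc d → ℝ, Mol ε ξ := by
  let φ : ContDiffBump (0 : Euc d) := ⟨ε / 2, ε, by positivity, by linarith⟩
  refine ⟨φ.normed volume, φ.contDiff_normed, φ.hasCompactSupport_normed, φ.nonneg_normed,
    φ.integral_normed, fun z hz => ?_⟩
  have h := φ.support_normed_eq (μ := (volume : Measure (Euc d)))
  by_contra hne
  have : z ∈ Function.support (φ.normed volume) := hne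
  rw [h] at this
  simp only [Metric.mem_ball, dist_zero_right] at this
  exact absurd this (not_lt.2 hz)

/-- Mollification. -/
def moll (ξ w : Euc d → ℝ) (x : Euc d) : ℝ := ∫ z, ξ z * w (x - z)

lemma moll_eq (ξ w : Euc d → ℝ) :
    moll ξ w = convolution ξ w (ContinuousLinearMap.lsmul ℝ ℝ) volume := by
  ext x; simp [moll, convolution]

section M
variable {ε : ℝ} {ξ : Euc d → ℝ} (hξ : Mol ε ξ)

include hξ

lemma Mol.integrable : Integrable ξ :=
  hξ.smooth.continuous.integrable_of_hasCompactSupport hξ.cs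

lemma Mol.integrable_mul {w : Euc d → ℝ} (hw : Continuous w) (x : Euc d) :
    Integrable fun z => ξ z * w (x - z) :=
  (hξ.smooth.continuous.mul (hw.comp (continuous_const.sub continuous_id))).integrable_of_hasCompactSupport
    hξ.cs.mul_right

/-- averaging inequality -/
lemma Mol.avg {F : Euc d → ℝ} {B : ℝ} (hF : ∀ z, ‖z‖ < ε → |F z| ≤ B) :
    |∫ z, ξ z * F z| ≤ B := by
  have h : ‖∫ z, ξ z * F z‖ ≤ ∫ z, ξ z * B := by
    refine norm_integral_le_of_norm_le (hξ.integrable.mul_const B) (Eventually.of_forall fun z => ?_)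
    rcases lt_or_ge ‖z‖ ε with hz | hz
    · rw [norm_mul, Real.norm_eq_abs, abs_of_nonneg (hξ.nonneg z)]
      exact mul_le_mul_of_nonneg_left (hF z hz) (hξ.nonneg z)
    · simp [hξ.supp z hz]
  rwa [integral_mul_const, hξ.int, one_mul] at h

lemma Mol.avg_const (c : ℝ) : ∫ z, ξ z * c = c := by
  rw [integral_mul_const, hξ.int, one_mul]

lemma moll_tst {M R : ℝ} {w : Euc d → ℝ} (hw : Tst M R w) : Tst M (R + ε) (moll ξ w) := by
  refine ⟨fun x => hξ.avg fun z _ => hw.bdd _, fun x y => ?_, fun x hx => ?_⟩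
  · simp only [moll]
    rw [← integral_sub (hξ.integrable_mul hw.cont x) (hξ.integrable_mul hw.cont y)]
    simp_rw [← mul_sub]
    refine hξ.avg fun z _ => ?_
    have := hw.lip (x - z) (y - z)
    rwa [sub_sub_sub_cancel_right] at this
  · have : ∀ z, ξ z * w (x - z) = 0 := by
      intro z
      rcases lt_or_ge ‖z‖ ε with hz | hz
      · rw [hw.supp, mul_zero]
        have := norm_sub_norm_le x z
        linarith
      · simp [hξ.supp z hz]
    simp [moll, this]

lemma moll_close {M R : ℝ} {w : Euc d → ℝ} (hw : Tst M R w) (x : Euc d) :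
    |moll ξ w x - w x| ≤ M * ε := by
  rw [← hξ.avg_const (w x), moll, ← integral_sub (hξ.integrable_mul hw.cont x)
    (hξ.integrable.mul_const _)]
  simp_rw [← mul_sub]
  refine hξ.avg fun z hz => (hw.lip _ _).trans ?_
  apply mul_le_mul_of_nonneg_left _ hw.nonneg
  rw [sub_sub_cancel_left, norm_neg]; exact hz.le

lemma moll_smooth {w : Euc d → ℝ} (hw : Continuous w) : ContDiff ℝ (⊤ : ℕ∞) (moll ξ w) := by
  rw [moll_eq]
  exact hξ.cs.contDiff_convolution_left _ hξ.smooth hw.locallyIntegrable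

lemma moll_fderiv_lip {M R : ℝ} {w : Euc d → ℝ} (hw : Tst M R w) (x y : Euc d) :
    ‖fderiv ℝ (moll ξ w) x - fderiv ℝ (moll ξ w) y‖ ≤ (∫ z, ‖fderiv ℝ ξ z‖) * M * ‖x - y‖ := by
  have hd : ∀ x, fderiv ℝ (moll ξ w) x =
      ∫ z, w (x - z) • fderiv ℝ ξ z := by
    intro x
    have := (hξ.cs.hasFDerivAt_convolution_left (ContinuousLinearMap.lsmul ℝ ℝ)
      (μ := (volume : Measure (Euc d)))
      (hξ.smooth.of_le (by simp)) hw.cont.locallyIntegrable x).fderiv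
    rw [moll_eq, this]
    simp only [convolution]
    congr 1; ext z v
    simp [ContinuousLinearMap.precompL_apply, mul_comm]
  have hfc : Continuous (fderiv ℝ ξ) := hξ.smooth.continuous_fderiv (by simp)
  have hfcs : HasCompactSupport (fderiv ℝ ξ) := hξ.cs.fderiv ℝ
  have hfi : Integrable (fun z => ‖fderiv ℝ ξ z‖) :=
    (hfc.integrable_of_hasCompactSupport hfcs).norm
  have hi : ∀ x, Integrable fun z => w (x - z) • fderiv ℝ ξ z := fun x => by
    have h0 : Integrable (fderiv ℝ ξ) := hfc.integrable_of_hasCompactSupport hfcs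
    have hwc : AEStronglyMeasurable (fun z => w (x - z)) (volume : Measure (Euc d)) :=
      (hw.cont.comp (continuous_const.sub continuous_id)).aestronglyMeasurable
    exact h0.bdd_smul M hwc (Eventually.of_forall fun z => hw.bdd _)
  rw [hd, hd, ← integral_sub (hi x) (hi y), mul_assoc, ← integral_mul_const]
  refine norm_integral_le_of_norm_le (hfi.mul_const _) (Eventually.of_forall fun z => ?_)
  rw [← sub_smul, norm_smul, mul_comm]
  apply mul_le_mul_of_nonneg_left _ (norm_nonneg _)
  have := hw.lip (x - z) (y - z)
  rwa [sub_sub_sub_cancel_right] at this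

lemma moll_fderiv_le {M R : ℝ} {w : Euc d → ℝ} (hw : Tst M R w) (x : Euc d) :
    ‖fderiv ℝ (moll ξ w) x‖ ≤ M := by
  have h := moll_tst hξ hw
  have : LipschitzWith (Real.toNNReal M) (moll ξ w) := LipschitzWith.of_dist_le_mul fun x y => by
    rw [Real.coe_toNNReal _ h.nonneg, dist_eq_norm, dist_eq_norm]
    exact h.lip x y
  have h2 := norm_fderiv_le_of_lipschitz ℝ this (x₀ := x)
  rwa [Real.coe_toNNReal _ h.nonneg] at h2

lemma moll_taylor {M R : ℝ} {w : Euc d → ℝ} (hw : Tst M R w) (x V : Euc d) :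
    |moll ξ w (x + V) - moll ξ w x - fderiv ℝ (moll ξ w) x V| ≤
      (∫ z, ‖fderiv ℝ ξ z‖) * M * ‖V‖ ^ 2 := by
  have hdiff : Differentiable ℝ (moll ξ w) := (moll_smooth hξ hw.cont).differentiable (by simp)
  have hK : 0 ≤ (∫ z, ‖fderiv ℝ ξ z‖) * M :=
    mul_nonneg (integral_nonneg fun _ => norm_nonneg _) hw.nonneg
  have := (convex_closedBall x ‖V‖).norm_image_sub_le_of_norm_fderiv_le' (f := moll ξ w) (𝕜 := ℝ)
    (φ := fderiv ℝ (moll ξ w) x) (x := x) (y := x + V)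
    (C := (∫ z, ‖fderiv ℝ ξ z‖) * M * ‖V‖) (fun z _ => hdiff z) ?_ (by simp) (by simp)
  · rw [add_sub_cancel_left] at this
    rw [← Real.norm_eq_abs]
    refine this.trans_eq (by ring)
  · intro z hz
    refine (moll_fderiv_lip hξ hw z x).trans ?_
    apply mul_le_mul_of_nonneg_left _ hK
    rwa [mem_closedBall_iff_norm] at hz

lemma moll_local {M R M' R' B ω : ℝ} {w w' : Euc d → ℝ} (hw : Tst M R w) (hw' : Tst M' R' w')
    (hω : 0 ≤ ω)
    (hε : 0 ≤ ε) {V : Euc d → Euc d} {G : Euc d → ℝ}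
    (hV : ∀ x y, ‖V x - V y‖ ≤ ω * ‖x - y‖) (hV0 : ∀ x, ‖V x‖ ≤ ω)
    (hG : ∀ x y, |G x - G y| ≤ ω * ‖x - y‖)
    (h : ∀ x, |w' x - (w (x + V x) + G x * w x)| ≤ B) (x : Euc d) :
    |moll ξ w' x - moll ξ w x - (fderiv ℝ (moll ξ w) x (V x) + moll ξ w x * G x)| ≤
      B + 2 * M * ω * ε + (∫ z, ‖fderiv ℝ ξ z‖) * M * ω ^ 2 := by
  have hM := hw.nonneg
  have hK : 0 ≤ (∫ z, ‖fderiv ℝ ξ z‖) * M :=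
    mul_nonneg (integral_nonneg fun _ => norm_nonneg _) hw.nonneg
  have h1 : |moll ξ w' x - (moll ξ w (x + V x) + moll ξ w x * G x)| ≤ B + 2 * M * ω * ε := by
    have e : moll ξ w' x - (moll ξ w (x + V x) + moll ξ w x * G x) =
        ∫ z, ξ z * (w' (x - z) - (w (x + V x - z) + w (x - z) * G x)) := by
      simp only [moll]
      have hi : Integrable (fun z => ξ z * w (x + V x - z) + ξ z * w (x - z) * G x) :=
        (hξ.integrable_mul hw.cont _).add ((hξ.integrable_mul hw.cont _).mul_const _)
      rw [← integral_mul_const, ← integral_add (hξ.integrable_mul hw.cont _)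
        ((hξ.integrable_mul hw.cont _).mul_const _), ← integral_sub (hξ.integrable_mul hw'.cont x) hi]
      congr 1; ext z; ring
    rw [e]
    refine hξ.avg fun z hz => ?_
    have a1 := h (x - z)
    have nz : ‖x - z - x‖ ≤ ε := by rw [sub_sub_cancel_left, norm_neg]; exact hz.le
    have a2 : |w (x - z + V (x - z)) - w (x + V x - z)| ≤ M * (ω * ε) := by
      refine (hw.lip _ _).trans (mul_le_mul_of_nonneg_left ?_ hM)
      rw [show x - z + V (x - z) - (x + V x - z) = V (x - z) - V x by abel]
      exact (hV _ _).trans (mul_le_mul_of_nonneg_left nz hω)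
    have a3 : |(G (x - z) - G x) * w (x - z)| ≤ (ω * ε) * M := by
      rw [abs_mul]
      exact mul_le_mul ((hG _ _).trans (mul_le_mul_of_nonneg_left nz hω)) (hw.bdd _)
        (abs_nonneg _) (by positivity)
    have e2 : w' (x - z) - (w (x + V x - z) + w (x - z) * G x) =
      (w' (x - z) - (w (x - z + V (x - z)) + G (x - z) * w (x - z)))
      + (w (x - z + V (x - z)) - w (x + V x - z)) + (G (x - z) - G x) * w (x - z) := by ring
    rw [e2]
    refine (abs_add_le _ _).trans ?_
    have := abs_add_le (w' (x - z) - (w (x - z + V (x - z)) + G (x - z) * w (x - z)))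
      (w (x - z + V (x - z)) - w (x + V x - z))
    linarith
  have h2 := moll_taylor hξ hw x (V x)
  have h3 : (∫ z, ‖fderiv ℝ ξ z‖) * M * ‖V x‖ ^ 2 ≤ (∫ z, ‖fderiv ℝ ξ z‖) * M * ω ^ 2 :=
    mul_le_mul_of_nonneg_left (pow_le_pow_left₀ (norm_nonneg _) (hV0 x) 2) hK
  have e : moll ξ w' x - moll ξ w x - (fderiv ℝ (moll ξ w) x (V x) + moll ξ w x * G x) =
    (moll ξ w' x - (moll ξ w (x + V x) + moll ξ w x * G x)) +
    (moll ξ w (x + V x) - moll ξ w x - fderiv ℝ (moll ξ w) x (V x)) := by ring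
  rw [e]
  refine (abs_add_le _ _).trans ?_
  linarith
end M

/-! ### Part 5: one-dimensional du Bois-Reymond argument -/

lemma step_fn {δ : ℝ} (hδ : 0 < δ) : ∃ Ψ ψ : ℝ → ℝ, ContDiff ℝ (⊤ : ℕ∞) Ψ ∧
    (∀ t, HasDerivAt Ψ (ψ t) t) ∧ Continuous ψ ∧ (∀ t, 0 ≤ ψ t) ∧ (∀ t, δ ≤ |t| → ψ t = 0) ∧
    Integrable ψ ∧ (∫ t, ψ t = 1) ∧ (∀ t ≤ -δ, Ψ t = 0) ∧ (∀ t, δ ≤ t → Ψ t = 1) ∧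
    (∀ t, |Ψ t| ≤ 1) := by
  let φ : ContDiffBump (0 : ℝ) := ⟨δ / 2, δ, by positivity, by linarith⟩
  set ψ : ℝ → ℝ := φ.normed volume with hψ
  have hsm : ContDiff ℝ (⊤ : ℕ∞) ψ := φ.contDiff_normed
  have hc : Continuous ψ := hsm.continuous
  have hnn : ∀ t, 0 ≤ ψ t := φ.nonneg_normed
  have hsupp : ∀ t, δ ≤ |t| → ψ t = 0 := by
    intro z hz
    have h := φ.support_normed_eq (μ := (volume : Measure ℝ))
    by_contra hne
    have : z ∈ Function.support (φ.normed volume) := hne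
    rw [h] at this
    simp only [Metric.mem_ball, dist_zero_right] at this
    exact absurd this (not_lt.2 hz)
  have hinteg : Integrable ψ := hc.integrable_of_hasCompactSupport φ.hasCompactSupport_normed
  have hone : ∫ t, ψ t = 1 := φ.integral_normed
  have hder : ∀ t, HasDerivAt (fun t => ∫ r in (-δ)..t, ψ r) (ψ t) t := fun t =>
    (hc.integral_hasStrictDerivAt (-δ) t).hasDerivAt
  have hz : ∀ t ≤ -δ, ∫ r in (-δ)..t, ψ r = 0 := by
    intro t ht
    rw [intervalIntegral.integral_congr (g := fun _ => 0), intervalIntegral.integral_zero]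
    intro r hr
    rw [uIcc_of_ge ht] at hr
    exact hsupp r (by rw [abs_of_nonpos (by linarith [hr.2])]; linarith [hr.2])
  have ho : ∀ t, δ ≤ t → ∫ r in (-δ)..t, ψ r = 1 := by
    intro t ht
    rw [← hone]
    apply intervalIntegral.integral_eq_integral_of_support_subset
    intro r hr
    by_contra hn
    apply hr
    apply hsupp
    by_contra hlt
    rw [not_le, abs_lt] at hlt
    exact hn ⟨hlt.1, by linarith [hlt.2]⟩
  have hmono : Monotone (fun t => ∫ r in (-δ)..t, ψ r) :=
    monotone_of_hasDerivAt_nonneg hder hnn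
  refine ⟨fun t => ∫ r in (-δ)..t, ψ r, ψ, ?_, hder, hc, hnn, hsupp, hinteg, hone, hz, ho, ?_⟩
  · rw [contDiff_infty_iff_deriv]
    refine ⟨fun t => (hder t).differentiableAt, ?_⟩
    rwa [show deriv (fun t => ∫ r in (-δ)..t, ψ r) = ψ from funext fun t => (hder t).deriv]
  · intro t
    have h1 := hmono (min_le_left t (-δ))
    have h2 := hmono (le_max_left t δ)
    simp only at h1 h2
    rw [hz _ (min_le_right _ _)] at h1
    rw [ho _ (le_max_right _ _)] at h2
    rw [abs_of_nonneg h1]; exact h2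

lemma dbr_open {A B : ℝ → ℝ} (hA : Continuous A) (hB : Integrable B)
    (h : ∀ η : ℝ → ℝ, ContDiff ℝ (⊤ : ℕ∞) η → HasCompactSupport η → tsupport η ⊆ Ioo 0 1 →
      ∫ t in Ioo (0:ℝ) 1, (deriv η t * A t + η t * B t) = 0)
    {a b : ℝ} (ha : 0 < a) (hab : a < b) (hb : b < 1) : A b - A a = ∫ r in a..b, B r := by
  set δ₀ := min (a / 2) ((1 - b) / 2) with hδ₀
  have hδ₀p : 0 < δ₀ := lt_min (by linarith) (by linarith)
  have hδa : δ₀ ≤ a / 2 := min_le_left _ _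
  have hδb : δ₀ ≤ (1 - b) / 2 := min_le_right _ _
  let δ : ℕ → ℝ := fun n => δ₀ / (n + 1)
  have hδ : ∀ n, 0 < δ n := fun n => by positivity
  have hδle : ∀ n, δ n ≤ δ₀ := fun n => div_le_self hδ₀p.le (by linarith [n.cast_nonneg (α := ℝ)])
  have hδlim : Tendsto δ atTop (𝓝 0) := by
    have := tendsto_one_div_add_atTop_nhds_zero_nat (𝕜 := ℝ)
    have := this.const_mul δ₀
    simpa [δ, div_eq_mul_inv] using this
  choose Ψ ψ hsm hder hc hnn hsupp hinteg hone hzero hone' hbd using fun n => step_fn (hδ n)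
  -- averages
  have havg : ∀ c : ℝ, Tendsto (fun n => ∫ t, ψ n (t - c) * A t) atTop (𝓝 (A c)) := by
    intro c
    rw [Metric.tendsto_atTop]
    intro e he
    obtain ⟨δ', hδ', hA'⟩ := Metric.continuous_iff.1 hA c (e / 2) (by positivity)
    obtain ⟨N, hN⟩ := Metric.tendsto_atTop.1 hδlim δ' hδ'
    refine ⟨N, fun n hn => ?_⟩
    have hn' : δ n < δ' := by
      have := hN n hn
      rw [dist_zero_right, Real.norm_eq_abs, abs_of_pos (hδ n)] at this; exact this
    have e1 : A c = ∫ t, ψ n (t - c) * A c := by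
      rw [integral_mul_const, integral_sub_right_eq_self (ψ n) c, hone, one_mul]
    have hcs : HasCompactSupport fun t => ψ n (t - c) := by
      refine HasCompactSupport.intro (isCompact_closedBall c (δ n)) fun t ht => hsupp n _ ?_
      rw [Metric.mem_closedBall, Real.dist_eq, not_le] at ht; exact ht.le
    have hcc : Continuous fun t => ψ n (t - c) := (hc n).comp (continuous_id.sub continuous_const)
    have i1 : Integrable fun t => ψ n (t - c) * A t :=
      (hcc.mul hA).integrable_of_hasCompactSupport hcs.mul_right
    have i0 : Integrable fun t => ψ n (t - c) := (hinteg n).comp_sub_right c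
    have i2 : Integrable fun t => ψ n (t - c) * A c := i0.mul_const _
    have : ‖(∫ t, ψ n (t - c) * A t) - A c‖ ≤ ∫ t, ψ n (t - c) * (e / 2) := by
      conv_lhs => rw [e1]
      rw [← integral_sub i1 i2]
      refine norm_integral_le_of_norm_le (i0.mul_const _) (Eventually.of_forall fun t => ?_)
      rw [← mul_sub, norm_mul, Real.norm_eq_abs, abs_of_nonneg (hnn n _)]
      rcases lt_or_ge |t - c| (δ n) with hlt | hge
      · exact mul_le_mul_of_nonneg_left (hA' t (by rw [Real.dist_eq]; linarith)).le (hnn n _)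
      · simp [hsupp n _ hge]
    rw [integral_mul_const, integral_sub_right_eq_self (ψ n) c, hone, one_mul] at this
    rw [dist_eq_norm]; linarith
  -- the test functions
  let η : ℕ → ℝ → ℝ := fun n t => Ψ n (t - a) - Ψ n (t - b)
  have hηd : ∀ n t, HasDerivAt (η n) (ψ n (t - a) - ψ n (t - b)) t := fun n t =>
    ((hder n (t - a)).comp_sub_const t a).sub ((hder n (t - b)).comp_sub_const t b)
  have hη0 : ∀ n t, t ∉ Icc (a - δ₀) (b + δ₀) → η n t = 0 := by
    intro n t ht
    have h1 := hδle n
    rw [mem_Icc, not_and_or, not_le, not_le] at ht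
    rcases ht with ht | ht
    · simp only [η]
      rw [hzero n _ (by linarith), hzero n _ (by linarith), sub_zero]
    · simp only [η]
      rw [hone' n _ (by linarith), hone' n _ (by linarith), sub_self]
  have hsub : Icc (a - δ₀) (b + δ₀) ⊆ Ioo 0 1 := fun t ht =>
    ⟨by linarith [ht.1], by linarith [ht.2]⟩
  have hts : ∀ n, tsupport (η n) ⊆ Icc (a - δ₀) (b + δ₀) := fun n =>
    closure_minimal (fun t ht => by by_contra hn; exact ht (hη0 n t hn)) isClosed_Icc
  have hzeroI : ∀ n, ∫ t in Ioo (0:ℝ) 1, (deriv (η n) t * A t + η n t * B t) = 0 := fun n =>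
    h (η n) (((hsm n).comp (contDiff_id.sub contDiff_const)).sub
      ((hsm n).comp (contDiff_id.sub contDiff_const)))
      (HasCompactSupport.intro isCompact_Icc fun t ht => hη0 n t ht) ((hts n).trans hsub)
  have hηc : ∀ n, Continuous (η n) := fun n => continuous_iff_continuousAt.2 fun t =>
    (hηd n t).continuousAt
  have hηb : ∀ n t, |η n t| ≤ 2 := fun n t => by
    have := hbd n (t - a); have h2 := hbd n (t - b)
    have := abs_sub (Ψ n (t - a)) (Ψ n (t - b))
    simp only [η]; linarith
  have iB : ∀ n, Integrable fun t => η n t * B t := fun n =>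
    hB.bdd_mul (c := 2) (hηc n).aestronglyMeasurable (Eventually.of_forall fun t => hηb n t)
  have iA : ∀ n c, Integrable fun t => ψ n (t - c) * A t := fun n c => by
    have hcs : HasCompactSupport fun t => ψ n (t - c) := by
      refine HasCompactSupport.intro (isCompact_closedBall c (δ n)) fun t ht => hsupp n _ ?_
      rw [Metric.mem_closedBall, Real.dist_eq, not_le] at ht; exact ht.le
    have hcc : Continuous fun t => ψ n (t - c) := (hc n).comp (continuous_id.sub continuous_const)
    exact (hcc.mul hA).integrable_of_hasCompactSupport hcs.mul_right
  have hall : ∀ n, (∫ t, ψ n (t - a) * A t) - (∫ t, ψ n (t - b) * A t) + ∫ t, η n t * B t = 0 := by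
    intro n
    rw [← hzeroI n, setIntegral_eq_integral_of_forall_compl_eq_zero]
    · have iD : Integrable fun t => ψ n (t - a) * A t - ψ n (t - b) * A t :=
        (iA n a).sub (iA n b)
      rw [← integral_sub (iA n a) (iA n b), ← integral_add iD (iB n)]
      congr 1; ext t
      rw [(hηd n t).deriv]; ring
    · intro t ht
      have htn : t ∉ tsupport (η n) := fun h' => ht (hsub (hts n h'))
      rw [image_eq_zero_of_notMem_tsupport htn, zero_mul, add_zero]
      have : deriv (η n) t = 0 := by
        by_contra hne
        exact htn (support_deriv_subset hne)
      rw [this, zero_mul]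
  have hlimB : Tendsto (fun n => ∫ t, η n t * B t) atTop
      (𝓝 (∫ t, (Ioc a b).indicator B t)) := by
    refine tendsto_integral_of_dominated_convergence (fun t => 2 * ‖B t‖)
      (fun n => (iB n).aestronglyMeasurable) (hB.norm.const_mul 2) (fun n => Eventually.of_forall
      fun t => ?_) ?_
    · rw [norm_mul]
      exact mul_le_mul_of_nonneg_right (hηb n t) (norm_nonneg _)
    · have hne : ∀ᵐ t : ℝ, t ≠ a ∧ t ≠ b := by
        have h1 : ∀ᵐ t : ℝ, t ≠ a := by simp [ae_iff]
        have h2 : ∀ᵐ t : ℝ, t ≠ b := by simp [ae_iff]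
        exact h1.and h2
      filter_upwards [hne] with t ht
      apply tendsto_const_nhds.congr'
      have e1 : ∀ᶠ n in atTop, δ n < |t - a| :=
        hδlim.eventually_lt_const (abs_pos.2 (sub_ne_zero.2 ht.1))
      have e2 : ∀ᶠ n in atTop, δ n < |t - b| :=
        hδlim.eventually_lt_const (abs_pos.2 (sub_ne_zero.2 ht.2))
      filter_upwards [e1, e2] with n h1 h2
      have hn := hδ n
      have key : ∀ c, δ n < |t - c| → Ψ n (t - c) = if c < t then 1 else 0 := by
        intro c hcn
        split_ifs with hct
        · rw [abs_of_pos (by linarith)] at hcn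
          exact hone' n _ hcn.le
        · rw [abs_of_nonpos (by linarith)] at hcn
          exact hzero n _ (by linarith)
      simp only [η]
      rw [key a h1, key b h2]
      by_cases hta : a < t
      · by_cases htb : b < t
        · rw [indicator_of_notMem (fun hh => absurd hh.2 (not_le.2 htb)), if_pos hta, if_pos htb]
          simp
        · rw [indicator_of_mem (show t ∈ Ioc a b from ⟨hta, not_lt.1 htb⟩), if_pos hta, if_neg htb]
          simp
      · have htb : ¬ b < t := fun hh => hta (hab.trans hh)
        rw [indicator_of_notMem (fun hh => hta hh.1), if_neg hta, if_neg htb]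
        simp
  have hlim := ((havg a).sub (havg b)).add hlimB
  have := tendsto_nhds_unique (hlim.congr hall) tendsto_const_nhds
  rw [integral_indicator measurableSet_Ioc, ← intervalIntegral.integral_of_le hab.le] at this
  linarith

lemma dbr {A B : ℝ → ℝ} (hA : Continuous A) (hB : Integrable B)
    (h : ∀ η : ℝ → ℝ, ContDiff ℝ (⊤ : ℕ∞) η → HasCompactSupport η → tsupport η ⊆ Ioo 0 1 →
      ∫ t in Ioo (0:ℝ) 1, (deriv η t * A t + η t * B t) = 0)
    {s t : ℝ} (hs : s ∈ Icc (0:ℝ) 1) (ht : t ∈ Icc (0:ℝ) 1) : A t - A s = ∫ r in s..t, B r := by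
  have hLc := LL_cont hB
  have hP : EqOn (fun t => A t - LL B t) (fun _ => A (1/2) - LL B (1/2)) (Ioo 0 1) := by
    intro x hx
    rcases lt_trichotomy x (1/2) with h1 | h1 | h1
    · have := dbr_open hA hB h hx.1 h1 (by norm_num)
      rw [LL_sub hB] at this
      simp only; linarith
    · rw [h1]
    · have := dbr_open hA hB h (by norm_num) h1 hx.2
      rw [LL_sub hB] at this
      simp only; linarith
  have hP2 := hP.closure (hA.sub hLc) continuous_const
  rw [closure_Ioo (by norm_num)] at hP2
  have h1 := hP2 hs
  have h2 := hP2 ht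
  rw [LL_sub hB]
  simp only at h1 h2
  linarith

/-! ### Part 6: narrowly continuous curves of measures -/

/-- A narrowly continuous curve of finite measures solving the continuity equation. -/
structure Crv (v : ℝ × Euc d → Euc d) (g : ℝ × Euc d → ℝ) (m : ℝ)
    (μ : ℝ → Measure (Euc d)) : Prop where
  fin : ∀ t, IsFiniteMeasure (μ t)
  mass : ∀ t, (μ t).real univ ≤ m
  cont : ∀ φ : Euc d → ℝ, Continuous φ → (∃ M, ∀ x, |φ x| ≤ M) →
    Continuous fun t => ∫ x, φ x ∂(μ t)
  ce : SolvesCE μ v g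

lemma integrable_of_bdd (μ : Measure (Euc d)) [IsFiniteMeasure μ] {h : Euc d → ℝ} {K : ℝ}
    (hh : Measurable h) (hK : ∀ x, |h x| ≤ K) : Integrable h μ :=
  Integrable.of_bound hh.aestronglyMeasurable K (Eventually.of_forall hK)

section Crv
variable {v : ℝ × Euc d → Euc d} {g : ℝ × Euc d → ℝ} {m : ℝ} {μ : ℝ → Measure (Euc d)}
  (hμ : Crv v g m μ)

include hμ

lemma Crv.m_nonneg : 0 ≤ m := measureReal_nonneg.trans (hμ.mass 0)

lemma Crv.meas : Measurable μ := by
  have := hμ.fin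
  have hcl : ∀ F : Set (Euc d), IsClosed F → Measurable fun t => μ t F := by
    intro F hF
    have hp : ∀ n : ℕ, (0:ℝ) < 1 / (n + 1) := fun n => by positivity
    have hm : Measurable fun t => (μ t).real F := by
      refine measurable_of_tendsto_metrizable
        (f := fun (n : ℕ) t => ∫ x, (thickenedIndicator (hp n) F x : ℝ) ∂(μ t)) (fun n => ?_) ?_
      · refine (hμ.cont _ (by fun_prop) ⟨1, fun x => ?_⟩).measurable
        rw [abs_of_nonneg (by positivity)]
        exact thickenedIndicator_le_one (hp n) F x
      · rw [tendsto_pi_nhds]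
        intro t
        exact tendsto_integral_thickenedIndicator_of_isClosed (μ t) hF hp
          tendsto_one_div_add_atTop_nhds_zero_nat
    have : (fun t => μ t F) = fun t => ENNReal.ofReal ((μ t).real F) := by
      ext t; simp
    rw [this]
    exact hm.ennreal_ofReal
  refine Measurable.measure_of_isPiSystem (S := {s | IsClosed s}) ?_ isPiSystem_isClosed
    (fun s hs => hcl s hs) (hcl _ isClosed_univ)
  rw [BorelSpace.measurable_eq (α := Euc d), borel_eq_generateFrom_isClosed]

lemma Crv.smeas {h : ℝ × Euc d → ℝ} (hh : Measurable h) :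
    StronglyMeasurable fun t => ∫ x, h (t, x) ∂(μ t) := by
  let κ : ProbabilityTheory.Kernel ℝ (Euc d) := ⟨μ, hμ.meas⟩
  have : ProbabilityTheory.IsFiniteKernel κ := by
    refine ⟨ENNReal.ofReal m, ENNReal.ofReal_lt_top, fun t => ?_⟩
    have := hμ.fin t
    change μ t univ ≤ _
    rw [← ofReal_measureReal]
    exact ENNReal.ofReal_le_ofReal (hμ.mass t)
  exact MeasureTheory.StronglyMeasurable.integral_kernel_prod_right' (κ := κ)
    hh.stronglyMeasurable

lemma Crv.norm_le {h : Euc d → ℝ} {K : ℝ} (t : ℝ) (hK : ∀ x, |h x| ≤ K) :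
    |∫ x, h x ∂(μ t)| ≤ K * m := by
  have := hμ.fin t
  have h0 : 0 ≤ K := (abs_nonneg _).trans (hK 0)
  have := norm_integral_le_of_norm_le_const (μ := μ t) (f := h) (C := K)
    (Eventually.of_forall hK)
  exact this.trans (mul_le_mul_of_nonneg_left (hμ.mass t) h0)

lemma Crv.integrable {C : ℝ → ℝ} (hC : Integrable C) {h : ℝ × Euc d → ℝ} (hh : Measurable h)
    {K : ℝ} (hK : ∀ t x, |h (t, x)| ≤ K * C t) :
    Integrable fun t => ∫ x, h (t, x) ∂(μ t) := by
  refine ((hC.const_mul K).mul_const m).mono' (hμ.smeas hh).aestronglyMeasurable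
    (Eventually.of_forall fun t => ?_)
  exact hμ.norm_le t (hK t)

/-- weak formulation with smooth compactly supported time-independent test functions -/
lemma Crv.weak {C : ℝ → ℝ} (hC : Integrable C) (hv : Car C v) (hg : Car C g)
    {f : Euc d → ℝ} (hf : ContDiff ℝ (⊤ : ℕ∞) f) (hfs : HasCompactSupport f)
    {s t : ℝ} (hs : s ∈ Icc (0:ℝ) 1) (ht : t ∈ Icc (0:ℝ) 1) :
    (∫ x, f x ∂(μ t)) - (∫ x, f x ∂(μ s)) =
      ∫ r in s..t, ∫ x, (fderiv ℝ f x (v (r, x)) + f x * g (r, x)) ∂(μ r) := by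
  have hfc : Continuous (fderiv ℝ f) := hf.continuous_fderiv (by simp)
  obtain ⟨M1, hM1⟩ := hf.continuous.bounded_above_of_compact_support hfs
  obtain ⟨M2, hM2⟩ := hfc.bounded_above_of_compact_support (hfs.fderiv ℝ)
  have hmeas : Measurable fun p : ℝ × Euc d => fderiv ℝ f p.2 (v p) + f p.2 * g p := by
    have h1 : Measurable fun p : ℝ × Euc d => fderiv ℝ f p.2 := hfc.measurable.comp measurable_snd
    have h2 : Measurable fun p : (Euc d →L[ℝ] ℝ) × Euc d => p.1 p.2 :=
      (isBoundedBilinearMap_apply (𝕜 := ℝ) (E := Euc d) (F := ℝ)).continuous.measurable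
    exact (h2.comp (h1.prodMk hv.meas)).add ((hf.continuous.measurable.comp measurable_snd).mul
      hg.meas)
  have hbd : ∀ r x, |fderiv ℝ f x (v (r, x)) + f x * g (r, x)| ≤ (M2 + M1) * C r := by
    intro r x
    have a1 : |fderiv ℝ f x (v (r, x))| ≤ M2 * C r :=
      ((fderiv ℝ f x).le_opNorm _).trans (mul_le_mul (hM2 x) (hv.bdd r x) (norm_nonneg _)
        ((norm_nonneg _).trans (hM2 x)))
    have a2 : |f x * g (r, x)| ≤ M1 * C r := by
      rw [abs_mul]
      exact mul_le_mul (hM1 x) (hg.bdd r x) (abs_nonneg _) ((norm_nonneg _).trans (hM1 x))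
    have := abs_add_le (fderiv ℝ f x (v (r, x))) (f x * g (r, x))
    linarith
  have hB := hμ.integrable hC hmeas hbd
  have hA := hμ.cont f hf.continuous ⟨M1, hM1⟩
  refine dbr hA hB (fun η hη hηs hηt => ?_) hs ht
  have hdf : Differentiable ℝ f := hf.differentiable (by simp)
  have hdη : Differentiable ℝ η := hη.differentiable (by simp)
  have hφ : IsTest (d := d) fun p => η p.1 * f p.2 := by
    have hsub : tsupport (fun p : XX d => η p.1 * f p.2) ⊆ tsupport η ×ˢ tsupport f := by
      refine closure_minimal (fun p hp => ?_) ((isClosed_tsupport _).prod (isClosed_tsupport _))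
      have hp' : η p.1 * f p.2 ≠ 0 := hp
      exact ⟨subset_tsupport _ (left_ne_zero_of_mul hp'), subset_tsupport _
        (right_ne_zero_of_mul hp')⟩
    refine ⟨(hη.comp contDiff_fst).mul (hf.comp contDiff_snd), ?_, fun p hp => ⟨hηt (hsub hp).1,
      mem_univ _⟩⟩
    exact (hηs.isCompact.prod hfs.isCompact).of_isClosed_subset (isClosed_tsupport _) hsub
  refine Eq.trans ?_ (hμ.ce _ hφ)
  refine setIntegral_congr_fun (measurableSet_Ioo (a := (0:ℝ)) (b := 1)) fun r _ => ?_
  have := hμ.fin r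
  simp only
  rw [← integral_const_mul, ← integral_const_mul, ← integral_add]
  · congr 1; ext x
    have hd1 : HasFDerivAt (fun p : XX d => η p.1 * f p.2)
        (η r • (fderiv ℝ f x).comp (ContinuousLinearMap.snd ℝ ℝ (Euc d)) +
          f x • ((fderiv ℝ η r).comp (ContinuousLinearMap.fst ℝ ℝ (Euc d)))) (r, x) := by
      have e1 : HasFDerivAt (fun p : XX d => η p.1)
          ((fderiv ℝ η r).comp (ContinuousLinearMap.fst ℝ ℝ (Euc d))) (r, x) :=
        HasFDerivAt.comp (r, x) (hdη r).hasFDerivAt hasFDerivAt_fst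
      have e2 : HasFDerivAt (fun p : XX d => f p.2)
          ((fderiv ℝ f x).comp (ContinuousLinearMap.snd ℝ ℝ (Euc d))) (r, x) :=
        HasFDerivAt.comp (r, x) (hdf x).hasFDerivAt hasFDerivAt_snd
      exact e1.mul e2
    rw [hd1.fderiv]
    simp
    ring
  · exact (integrable_of_bdd (μ r) hf.continuous.measurable hM1).const_mul _
  · exact (integrable_of_bdd (μ r) (hmeas.comp measurable_prodMk_left) (hbd r)).const_mul _
end Crv

lemma Tst.hcs {M R : ℝ} {w : Euc d → ℝ} (h : Tst M R w) : HasCompactSupport w :=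
  HasCompactSupport.intro (isCompact_closedBall 0 R) fun x hx => h.supp x (by
    rwa [mem_closedBall_zero_iff, not_le] at hx)

lemma Tst.fderiv_zero {M R : ℝ} {w : Euc d → ℝ} (h : Tst M R w) {x : Euc d} (hx : R < ‖x‖) :
    fderiv ℝ w x = 0 := by
  by_contra hne
  have h1 : x ∈ tsupport w := support_fderiv_subset ℝ hne
  have h2 : tsupport w ⊆ Metric.closedBall 0 R := closure_minimal (fun y hy => by
    by_contra hn
    rw [mem_closedBall_zero_iff, not_le] at hn
    exact hy (h.supp y hn)) Metric.isClosed_closedBall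
  have h3 := h2 h1
  rw [mem_closedBall_zero_iff] at h3
  exact absurd hx (not_lt.2 h3)

lemma Tst.integrable {M R : ℝ} {w : Euc d → ℝ} (h : Tst M R w) (μ : Measure (Euc d))
    [IsFiniteMeasure μ] : Integrable w μ :=
  integrable_of_bdd μ h.cont.measurable h.bdd

section Step
variable {C : ℝ → ℝ} (hC : Integrable C) {v : ℝ × Euc d → Euc d} (hv : Car C v)
  {g : ℝ × Euc d → ℝ} (hg : Car C g) {m : ℝ} {μ : ℝ → Measure (Euc d)} (hμ : Crv v g m μ)

/-- the generator -/
def gen (v : ℝ × Euc d → Euc d) (g : ℝ × Euc d → ℝ) (f : Euc d → ℝ) (p : ℝ × Euc d) : ℝ :=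
  fderiv ℝ f p.2 (v p) + f p.2 * g p

include hv hg in
lemma gen_meas {f : Euc d → ℝ} (hf : ContDiff ℝ (⊤ : ℕ∞) f) : Measurable (gen v g f) := by
  have hfc : Continuous (fderiv ℝ f) := hf.continuous_fderiv (by simp)
  have h1 : Measurable fun p : ℝ × Euc d => fderiv ℝ f p.2 := hfc.measurable.comp measurable_snd
  have h2 : Measurable fun p : (Euc d →L[ℝ] ℝ) × Euc d => p.1 p.2 :=
    (isBoundedBilinearMap_apply (𝕜 := ℝ) (E := Euc d) (F := ℝ)).continuous.measurable
  exact (h2.comp (h1.prodMk hv.meas)).add ((hf.continuous.measurable.comp measurable_snd).mul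
    hg.meas)

include hv hg in
lemma gen_le {ε : ℝ} {ξ : Euc d → ℝ} (hξ : Mol ε ξ) {M R : ℝ} {w : Euc d → ℝ} (hw : Tst M R w)
    (r : ℝ) (x : Euc d) : |gen v g (moll ξ w) (r, x)| ≤ 2 * M * C r := by
  have hM := hw.nonneg
  have a1 : |fderiv ℝ (moll ξ w) x (v (r, x))| ≤ M * C r :=
    ((fderiv ℝ (moll ξ w) x).le_opNorm _).trans (mul_le_mul (moll_fderiv_le hξ hw x) (hv.bdd r x)
      (norm_nonneg _) hM)
  have a2 : |moll ξ w x * g (r, x)| ≤ M * C r := by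
    rw [abs_mul]
    exact mul_le_mul ((moll_tst hξ hw).bdd x) (hg.bdd r x) (abs_nonneg _) hM
  have := abs_add_le (fderiv ℝ (moll ξ w) x (v (r, x))) (moll ξ w x * g (r, x))
  simp only [gen]; linarith

include hv hg in
lemma gen_tst {ε : ℝ} {ξ : Euc d → ℝ} (hξ : Mol ε ξ) {M R : ℝ} {w : Euc d → ℝ} (hw : Tst M R w)
    (r : ℝ) : Tst (((∫ z, ‖fderiv ℝ ξ z‖) * M + 3 * M) * C r) (R + ε)
      (fun x => gen v g (moll ξ w) (r, x)) := by
  have hM := hw.nonneg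
  have hC0 := hv.nonneg r
  set Kξ := ∫ z, ‖fderiv ℝ ξ z‖ with hKξ
  have hK : 0 ≤ Kξ := integral_nonneg fun _ => norm_nonneg _
  have hf := moll_tst hξ hw
  refine ⟨fun x => (gen_le hv hg hξ hw r x).trans ?_, fun x y => ?_, fun x hx => ?_⟩
  · apply mul_le_mul_of_nonneg_right _ hC0
    have := mul_nonneg hK hM
    linarith
  · have e : gen v g (moll ξ w) (r, x) - gen v g (moll ξ w) (r, y) =
      (fderiv ℝ (moll ξ w) x - fderiv ℝ (moll ξ w) y) (v (r, x)) +
      fderiv ℝ (moll ξ w) y (v (r, x) - v (r, y)) +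
      (moll ξ w x - moll ξ w y) * g (r, x) + moll ξ w y * (g (r, x) - g (r, y)) := by
      simp only [gen, _root_.sub_apply, map_sub]; ring
    have hn := norm_nonneg (x - y)
    have b1 : |(fderiv ℝ (moll ξ w) x - fderiv ℝ (moll ξ w) y) (v (r, x))| ≤
        (Kξ * M * ‖x - y‖) * C r :=
      (ContinuousLinearMap.le_opNorm _ _).trans (mul_le_mul (moll_fderiv_lip hξ hw x y)
        (hv.bdd r x) (norm_nonneg _) (by positivity))
    have b2 : |fderiv ℝ (moll ξ w) y (v (r, x) - v (r, y))| ≤ M * (C r * ‖x - y‖) :=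
      (ContinuousLinearMap.le_opNorm _ _).trans (mul_le_mul (moll_fderiv_le hξ hw y)
        (hv.lip r x y) (norm_nonneg _) hM)
    have b3 : |(moll ξ w x - moll ξ w y) * g (r, x)| ≤ (M * ‖x - y‖) * C r := by
      rw [abs_mul]
      exact mul_le_mul (hf.lip x y) (hg.bdd r x) (abs_nonneg _) (by positivity)
    have b4 : |moll ξ w y * (g (r, x) - g (r, y))| ≤ M * (C r * ‖x - y‖) := by
      rw [abs_mul]
      exact mul_le_mul (hf.bdd y) (hg.lip r x y) (abs_nonneg _) hM
    rw [e]
    refine (abs_add_le _ _).trans ?_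
    refine (add_le_add_left (abs_add_le _ _) _).trans ?_
    refine (add_le_add_left (add_le_add_left (abs_add_le _ _) _) _).trans ?_
    refine (add_le_add (add_le_add (add_le_add b1 b2) b3) b4).trans (le_of_eq (by ring))
  · simp only [gen]
    rw [hf.supp x hx, hf.fderiv_zero hx]; simp

include hμ in
lemma Crv.close {f h : Euc d → ℝ} {K K' e : ℝ} (hf : Measurable f) (hh : Measurable h)
    (hfK : ∀ x, |f x| ≤ K) (hhK : ∀ x, |h x| ≤ K') (hfh : ∀ x, |f x - h x| ≤ e) (t : ℝ) :
    |(∫ x, f x ∂(μ t)) - ∫ x, h x ∂(μ t)| ≤ e * m := by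
  have := hμ.fin t
  rw [← integral_sub (integrable_of_bdd _ hf hfK) (integrable_of_bdd _ hh hhK)]
  exact hμ.norm_le t hfh

include hC hv hg hμ in
lemma Crv.lip {h : Euc d → ℝ} {K R : ℝ} (hh : Tst K R h) {s t : ℝ} (hs : s ∈ Icc (0:ℝ) 1)
    (ht : t ∈ Icc (0:ℝ) 1) (hst : s ≤ t) :
    |(∫ x, h x ∂(μ t)) - ∫ x, h x ∂(μ s)| ≤ 2 * K * m * (LL C t - LL C s) := by
  have hm := hμ.m_nonneg
  have hK := hh.nonneg
  have key : ∀ ε : ℝ, 0 < ε → |(∫ x, h x ∂(μ t)) - ∫ x, h x ∂(μ s)| ≤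
      2 * K * m * (LL C t - LL C s) + 2 * K * m * ε := by
    intro ε hε
    obtain ⟨ξ, hξ⟩ := exists_mol (d := d) hε
    have hf := moll_tst hξ hh
    have hw := hμ.weak hC hv hg (moll_smooth hξ hh.cont) hf.hcs hs ht
    have h1 : |(∫ x, moll ξ h x ∂(μ t)) - ∫ x, moll ξ h x ∂(μ s)| ≤
        2 * K * m * (LL C t - LL C s) := by
      rw [hw, ← LL_sub hC, ← intervalIntegral.integral_const_mul, ← Real.norm_eq_abs]
      refine intervalIntegral.norm_integral_le_of_norm_le hst
        (Eventually.of_forall fun r _ => ?_) (hC.const_mul _).intervalIntegrable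
      refine (hμ.norm_le r (gen_le hv hg hξ hh r)).trans (le_of_eq (by ring))
    have h2 := fun t => hμ.close hf.cont.measurable hh.cont.measurable hf.bdd hh.bdd
      (moll_close hξ hh) t
    have h3 := h2 t
    have h4 := h2 s
    rw [abs_le] at *
    constructor <;> linarith [h1.1, h1.2, h3.1, h3.2, h4.1, h4.2]
  refine le_of_forall_pos_le_add fun δ hδ => ?_
  have hp : 0 < 2 * K * m + 1 := by positivity
  refine (key (δ / (2 * K * m + 1)) (by positivity)).trans ?_
  gcongr
  rw [mul_div_assoc', div_le_iff₀ hp]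
  nlinarith

include hC hv hg hμ in
/-- One time step of the duality argument. -/
lemma Crv.step {ε : ℝ} (hε : 0 < ε) {ξ : Euc d → ℝ} (hξ : Mol ε ξ) {M R M' R' B : ℝ}
    {w w' : Euc d → ℝ}
    (hw : Tst M R w) (hw' : Tst M' R' w') {s t : ℝ} (hs : s ∈ Icc (0:ℝ) 1)
    (ht : t ∈ Icc (0:ℝ) 1) (hst : s ≤ t)
    (hB : ∀ x, |w' x - (w (x + ∫ r in s..t, v (r, x)) + (∫ r in s..t, g (r, x)) * w x)| ≤ B) :
    |(∫ x, moll ξ w x ∂(μ t)) - ∫ x, moll ξ w' x ∂(μ s)| ≤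
      (B + 2 * M * (LL C t - LL C s) * ε + (∫ z, ‖fderiv ℝ ξ z‖) * M * (LL C t - LL C s) ^ 2) * m +
      2 * ((∫ z, ‖fderiv ℝ ξ z‖) * M + 3 * M) * m * (LL C t - LL C s) ^ 2 := by
  have hm := hμ.m_nonneg
  have hM := hw.nonneg
  have hfin := hμ.fin
  set ω := LL C t - LL C s with hω
  have hω0 : 0 ≤ ω := sub_nonneg.2 (LL_mono hC hv.nonneg hst)
  set Kξ := ∫ z, ‖fderiv ℝ ξ z‖ with hKξ
  have hK : 0 ≤ Kξ := integral_nonneg fun _ => norm_nonneg _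
  set f := moll ξ w with hf
  have hft := moll_tst hξ hw
  have hft' := moll_tst hξ hw'
  have hfs : ContDiff ℝ (⊤ : ℕ∞) f := moll_smooth hξ hw.cont
  set V : Euc d → Euc d := fun x => ∫ r in s..t, v (r, x) with hVdef
  set G : Euc d → ℝ := fun x => ∫ r in s..t, g (r, x) with hGdef
  have hweak := hμ.weak hC hv hg hfs hft.hcs hs ht
  have hgm := gen_meas hv hg hfs
  have hgl := gen_le hv hg hξ hw
  -- time integrals
  have hgenint : ∀ x, ∫ r in s..t, gen v g f (r, x) = fderiv ℝ f x (V x) + f x * G x := by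
    intro x
    have iv : IntervalIntegrable (fun r => v (r, x)) volume s t :=
      (hv.integrable hC (measurable_const (a := x))).intervalIntegrable
    have ig : IntervalIntegrable (fun r => g (r, x)) volume s t :=
      (hg.integrable hC (measurable_const (a := x))).intervalIntegrable
    simp only [gen]
    rw [intervalIntegral.integral_add, intervalIntegral.integral_const_mul,
      ContinuousLinearMap.intervalIntegral_comp_comm _ iv]
    · exact ⟨(fderiv ℝ f x).integrable_comp iv.1, (fderiv ℝ f x).integrable_comp iv.2⟩
    · exact ig.const_mul _
  have hV : ∀ x y, ‖V x - V y‖ ≤ ω * ‖x - y‖ := by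
    intro x y
    have := hv.diff hC (continuous_const (y := x)) (continuous_const (y := y)) hst
    rwa [intervalIntegral.integral_mul_const, LL_sub hC] at this
  have hG : ∀ x y, |G x - G y| ≤ ω * ‖x - y‖ := by
    intro x y
    have := hg.diff hC (continuous_const (y := x)) (continuous_const (y := y)) hst
    rwa [intervalIntegral.integral_mul_const, LL_sub hC] at this
  have hV0 : ∀ x, ‖V x‖ ≤ ω := fun x => hv.int_le hC (fun _ => x) hst
  have hG0 : ∀ x, |G x| ≤ ω := fun x => hg.int_le hC (fun _ => x) hst
  have hloc := moll_local hξ hw hw' hω0 hε.le hV hV0 hG hB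
  -- Fubini
  have hfub : ∫ r in s..t, ∫ x, gen v g f (r, x) ∂(μ s) =
      ∫ x, (fderiv ℝ f x (V x) + f x * G x) ∂(μ s) := by
    simp_rw [← hgenint]
    rw [intervalIntegral.integral_of_le hst]
    simp_rw [intervalIntegral.integral_of_le hst]
    apply integral_integral_swap
    have hi : Integrable (fun p : ℝ × Euc d => 2 * M * C p.1)
        ((volume.restrict (Ioc s t)).prod (μ s)) :=
      ((hC.restrict (s := Ioc s t)).const_mul (2 * M)).comp_fst (μ s)
    exact hi.mono' hgm.aestronglyMeasurable (Eventually.of_forall fun p => hgl p.1 p.2)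
  -- replacing μ r with μ s
  have hE1 : |(∫ r in s..t, ∫ x, gen v g f (r, x) ∂(μ r)) -
      ∫ r in s..t, ∫ x, gen v g f (r, x) ∂(μ s)| ≤ 2 * (Kξ * M + 3 * M) * m * ω ^ 2 := by
    have i1 : IntervalIntegrable (fun r => ∫ x, gen v g f (r, x) ∂(μ r)) volume s t :=
      (hμ.integrable hC hgm hgl).intervalIntegrable
    have i2 : Integrable (fun r => ∫ x, gen v g f (r, x) ∂(μ s)) := by
      refine ((hC.const_mul (2 * M)).mul_const m).mono'
        (hgm.stronglyMeasurable.integral_prod_right').aestronglyMeasurable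
        (Eventually.of_forall fun r => hμ.norm_le s (hgl r))
    rw [← intervalIntegral.integral_sub i1 i2.intervalIntegrable]
    have e : 2 * (Kξ * M + 3 * M) * m * ω ^ 2 =
        ∫ r in s..t, (2 * (Kξ * M + 3 * M) * m * ω) * C r := by
      rw [intervalIntegral.integral_const_mul, LL_sub hC]; ring
    rw [e, ← Real.norm_eq_abs]
    refine intervalIntegral.norm_integral_le_of_norm_le hst
        (Eventually.of_forall fun r hr => ?_) (hC.const_mul _).intervalIntegrable
    have hr' : r ∈ Icc (0:ℝ) 1 := ⟨hs.1.trans hr.1.le, hr.2.trans ht.2⟩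
    refine (hμ.lip hC hv hg (gen_tst hv hg hξ hw r) hs hr' hr.1.le).trans ?_
    have : LL C r - LL C s ≤ ω := by
      have := LL_mono hC hv.nonneg hr.2
      linarith
    have hC0 := hv.nonneg r
    calc _ ≤ 2 * ((Kξ * M + 3 * M) * C r) * m * ω := by gcongr
      _ = _ := by ring
  -- spatial remainder
  have hdm : Measurable fun x => fderiv ℝ f x (V x) + f x * G x := by
    simp_rw [← hgenint]
    simp_rw [intervalIntegral.integral_of_le hst]
    exact (hgm.stronglyMeasurable.integral_prod_left').measurable
  have hdb : ∀ x, |fderiv ℝ f x (V x) + f x * G x| ≤ M * ω + M * ω := by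
    intro x
    have a1 : |fderiv ℝ f x (V x)| ≤ M * ω :=
      ((fderiv ℝ f x).le_opNorm _).trans (mul_le_mul (moll_fderiv_le hξ hw x) (hV0 x)
        (norm_nonneg _) hM)
    have a2 : |f x * G x| ≤ M * ω := by
      rw [abs_mul]
      exact mul_le_mul (hft.bdd x) (hG0 x) (abs_nonneg _) hM
    have := abs_add_le (fderiv ℝ f x (V x)) (f x * G x)
    linarith
  have hE2 : |(∫ x, moll ξ w' x ∂(μ s)) - (∫ x, f x ∂(μ s)) -
      ∫ x, (fderiv ℝ f x (V x) + f x * G x) ∂(μ s)| ≤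
      (B + 2 * M * ω * ε + Kξ * M * ω ^ 2) * m := by
    have i1 : Integrable (fun x => moll ξ w' x - f x) (μ s) :=
      (hft'.integrable (μ s)).sub (hft.integrable (μ s))
    rw [← integral_sub (hft'.integrable (μ s)) (hft.integrable (μ s)),
      ← integral_sub i1 (integrable_of_bdd (μ s) hdm hdb)]
    exact hμ.norm_le s hloc
  have hweak' : (∫ x, f x ∂(μ t)) - (∫ x, f x ∂(μ s)) =
      ∫ r in s..t, ∫ x, gen v g f (r, x) ∂(μ r) := hweak
  rw [hfub, ← hweak'] at hE1
  rw [abs_le] at *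
  constructor <;> linarith [hE1.1, hE1.2, hE2.1, hE2.2]
end Step

/-! ### Part 8: the duality identity and the representation formula -/

lemma partition_est {F L : ℝ → ℝ} (hL : Continuous L) (hm : Monotone L) {T A B : ℝ} (hT : 0 ≤ T)
    (hA : 0 ≤ A)
    (h : ∀ s t, 0 ≤ s → s ≤ t → t ≤ T → |F t - F s| ≤ A * (L t - L s) ^ 2 + B * (L t - L s)) :
    |F T - F 0| ≤ B * (L T - L 0) := by
  have hLT : 0 ≤ L T - L 0 := sub_nonneg.2 (hm hT)
  have key : ∀ e : ℝ, 0 < e → |F T - F 0| ≤ (A * e + B) * (L T - L 0) := by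
    intro e he
    obtain ⟨δ, hδ, hu⟩ := Metric.uniformContinuousOn_iff.1
      (isCompact_Icc.uniformContinuousOn_of_continuous (hL.continuousOn (s := Icc 0 T))) e he
    obtain ⟨N, hN⟩ := exists_nat_gt (T / δ)
    have hN0 : (0:ℝ) < N := lt_of_le_of_lt (by positivity) hN
    let τ : ℕ → ℝ := fun k => k * (T / N)
    have hstep : ∀ k, τ (k + 1) - τ k = T / N := fun k => by simp only [τ]; push_cast; ring
    have hTN : 0 ≤ T / N := by positivity
    have hle : ∀ k : ℕ, k ≤ N → τ k ≤ T := by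
      intro k hk
      have : (k : ℝ) ≤ N := by exact_mod_cast hk
      simp only [τ]
      calc (k : ℝ) * (T / N) ≤ N * (T / N) := by gcongr
        _ = T := by field_simp
    have h0 : ∀ k, 0 ≤ τ k := fun k => by positivity
    have hlt : T / N < δ := by
      rw [div_lt_iff₀ hδ] at hN
      rw [div_lt_iff₀ hN0]; linarith
    have ind : ∀ k : ℕ, k ≤ N → |F (τ k) - F 0| ≤ (A * e + B) * (L (τ k) - L 0) := by
      intro k
      induction k with
      | zero => intro _; simp [τ]
      | succ k ih =>
        intro hk
        have ih' := ih (by omega)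
        have hs := hstep k
        have hkk : τ k ≤ τ (k + 1) := by linarith
        have h1 := h (τ k) (τ (k + 1)) (h0 k) hkk (hle _ hk)
        have hmo : 0 ≤ L (τ (k + 1)) - L (τ k) := sub_nonneg.2 (hm hkk)
        have hd := hu (τ (k + 1)) ⟨h0 _, hle _ hk⟩ (τ k) ⟨h0 _, hle _ (by omega)⟩ (by
          rw [Real.dist_eq, hs, abs_of_nonneg hTN]; exact hlt)
        rw [Real.dist_eq, abs_of_nonneg hmo] at hd
        have h2 : A * (L (τ (k + 1)) - L (τ k)) ^ 2 ≤ A * e * (L (τ (k + 1)) - L (τ k)) := by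
          rw [sq, ← mul_assoc]
          gcongr
        have h3 : |F (τ (k + 1)) - F 0| ≤ |F (τ (k + 1)) - F (τ k)| + |F (τ k) - F 0| :=
          abs_sub_le _ _ _
        nlinarith
    have := ind N le_rfl
    have e1 : τ N = T := by simp only [τ]; field_simp
    rwa [e1] at this
  refine le_of_forall_pos_le_add fun δ hδ => ?_
  have hp : 0 < A * (L T - L 0) + 1 := by positivity
  refine (key (δ / (A * (L T - L 0) + 1)) (by positivity)).trans ?_
  have : A * (δ / (A * (L T - L 0) + 1)) * (L T - L 0) ≤ δ := by
    rw [mul_div_assoc', div_mul_eq_mul_div, div_le_iff₀ hp]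
    nlinarith
  linarith

section Rep
variable {C : ℝ → ℝ} (hC : Integrable C) {v : ℝ × Euc d → Euc d} (hv : Car C v)
  {g : ℝ × Euc d → ℝ} (hg : Car C g) {m : ℝ} {μ : ℝ → Measure (Euc d)} (hμ : Crv v g m μ)

include hg hμ in
lemma Crv.duality {φ : Euc d → ℝ} {M R : ℝ} (hφ : Tst M R φ) {T : ℝ} (hT : T ∈ Icc (0:ℝ) 1) :
    ∫ x, φ x ∂(μ T) = ∫ x, dual hC hv g φ T 0 x ∂(μ 0) := by
  obtain ⟨M', R', hd⟩ := dual_tst hC hv hg hφ T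
  have hM := (hd T le_rfl).nonneg
  have hm := hμ.m_nonneg
  have hLm := LL_mono hC hv.nonneg
  have hL0 : 0 ≤ LL C T - LL C 0 := sub_nonneg.2 (hLm hT.1)
  have hTT : dual hC hv g φ T T = φ := by
    ext x; simp [dual, flow_self]
  have key : ∀ ε : ℝ, 0 < ε → |(∫ x, φ x ∂(μ T)) - ∫ x, dual hC hv g φ T 0 x ∂(μ 0)| ≤
      (2 * M' * m * (LL C T - LL C 0) + 2 * M' * m) * ε := by
    intro ε hε
    obtain ⟨ξ, hξ⟩ := exists_mol (d := d) hε
    set Kξ := ∫ z, ‖fderiv ℝ ξ z‖ with hKξ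
    have hK : 0 ≤ Kξ := integral_nonneg fun _ => norm_nonneg _
    have hpart := partition_est (F := fun t => ∫ x, moll ξ (dual hC hv g φ T t) x ∂(μ t))
      (LL_cont hC) hLm (T := T)
      (A := (M' * (3 + Real.exp (∫ r, C r)) + Kξ * M') * m + 2 * (Kξ * M' + 3 * M') * m)
      (B := 2 * M' * ε * m) hT.1 (by positivity) (fun s t h0 hst htT => by
        have hst1 := hμ.step hC hv hg hε hξ (hd t htT) (hd s (hst.trans htT))
          ⟨h0, (hst.trans htT).trans hT.2⟩ ⟨h0.trans hst, htT.trans hT.2⟩ hst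
          (B := M' * (3 + Real.exp (∫ r, C r)) * (LL C t - LL C s) ^ 2) (fun x => by
            have := local_est hC hv hg (hd t htT) x hst
            rwa [← dual_semi hC hv hg φ x hst htT] at this)
        refine hst1.trans (le_of_eq ?_)
        ring)
    rw [hTT] at hpart
    have hφ' : Tst M' R' φ := hTT ▸ hd T le_rfl
    have h0' := hd 0 hT.1
    have h3 := hμ.close (moll_tst hξ hφ').cont.measurable hφ'.cont.measurable
      (moll_tst hξ hφ').bdd hφ'.bdd (moll_close hξ hφ') T
    have h4 := hμ.close (moll_tst hξ h0').cont.measurable h0'.cont.measurable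
      (moll_tst hξ h0').bdd h0'.bdd (moll_close hξ h0') 0
    rw [abs_le] at *
    constructor <;> linarith [hpart.1, hpart.2, h3.1, h3.2, h4.1, h4.2]
  have : |(∫ x, φ x ∂(μ T)) - ∫ x, dual hC hv g φ T 0 x ∂(μ 0)| ≤ 0 := by
    refine le_of_forall_pos_le_add fun δ hδ => ?_
    have hp : 0 < 2 * M' * m * (LL C T - LL C 0) + 2 * M' * m + 1 := by positivity
    refine (key (δ / (2 * M' * m * (LL C T - LL C 0) + 2 * M' * m + 1)) (by positivity)).trans ?_
    rw [mul_div_assoc', div_le_iff₀ hp]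
    nlinarith
  exact sub_eq_zero.1 (abs_nonpos_iff.1 this)

lemma thick_tst {K : Set (Euc d)} (hK : IsCompact K) (n : ℕ) (hp : (0:ℝ) < 1 / (n + 1)) :
    ∃ R, Tst (n + 1) R (fun x => (thickenedIndicator hp K x : ℝ)) := by
  obtain ⟨R, hR⟩ := hK.isBounded.subset_closedBall (0 : Euc d)
  have hn : (0:ℝ) ≤ n := n.cast_nonneg
  refine ⟨R + 1, fun x => ?_, fun x y => ?_, fun x hx => ?_⟩
  · rw [abs_of_nonneg (by positivity)]
    have : (thickenedIndicator hp K x : ℝ) ≤ 1 := thickenedIndicator_le_one hp K x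
    linarith
  · have := (lipschitzWith_thickenedIndicator hp K).dist_le_mul x y
    rw [dist_eq_norm x y] at this
    have e : (((1 / ((n:ℝ) + 1)).toNNReal⁻¹ : ℝ≥0) : ℝ) = n + 1 := by
      rw [NNReal.coe_inv, Real.coe_toNNReal _ hp.le]; simp
    rw [e] at this
    exact this
  · have : x ∉ Metric.thickening (1 / ((n:ℝ) + 1)) K := by
      intro hmem
      obtain ⟨z, hz, hxz⟩ := Metric.mem_thickening_iff.1 hmem
      have h1 := hR hz
      rw [mem_closedBall_zero_iff] at h1
      rw [dist_eq_norm] at hxz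
      have h2 := norm_sub_norm_le x z
      have h3 : 1 / ((n:ℝ) + 1) ≤ 1 := by
        rw [div_le_one (by linarith)]; linarith
      linarith
    rw [thickenedIndicator_zero hp K this]; simp

lemma ext_tst (μ ν : Measure (Euc d)) [IsFiniteMeasure μ] [IsFiniteMeasure ν]
    (h : ∀ (φ : Euc d → ℝ) (M R : ℝ), Tst M R φ → ∫ x, φ x ∂μ = ∫ x, φ x ∂ν) : μ = ν := by
  have hcpt : ∀ K : Set (Euc d), IsCompact K → μ K = ν K := by
    intro K hK
    have hp : ∀ n : ℕ, (0:ℝ) < 1 / (n + 1) := fun n => by positivity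
    have t1 := tendsto_integral_thickenedIndicator_of_isClosed μ hK.isClosed hp
      tendsto_one_div_add_atTop_nhds_zero_nat
    have t2 := tendsto_integral_thickenedIndicator_of_isClosed ν hK.isClosed hp
      tendsto_one_div_add_atTop_nhds_zero_nat
    have e : (fun n : ℕ => ∫ x, (thickenedIndicator (hp n) K x : ℝ) ∂μ) =
        fun n : ℕ => ∫ x, (thickenedIndicator (hp n) K x : ℝ) ∂ν := by
      ext n
      obtain ⟨R, hR⟩ := thick_tst hK n (hp n)
      exact h _ _ _ hR
    rw [e] at t1
    have := tendsto_nhds_unique t1 t2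
    rwa [measureReal_eq_measureReal_iff] at this
  ext s hs
  rw [hs.measure_eq_iSup_isCompact_of_ne_top (measure_ne_top _ _),
    hs.measure_eq_iSup_isCompact_of_ne_top (measure_ne_top _ _)]
  refine iSup_congr fun K => iSup_congr fun _ => iSup_congr fun hK => hcpt K hK

include hg hμ in
lemma Crv.repr {T : ℝ} (hT : T ∈ Icc (0:ℝ) 1) :
    μ T = Measure.map (fun x => flow hC hv 0 x T) ((μ 0).withDensity fun x =>
      ENNReal.ofReal (Real.exp (∫ s in (0:ℝ)..T, g (s, flow hC hv 0 x s)))) := by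
  have hf0 := hμ.fin 0
  have hfT := hμ.fin T
  have hfm : Measurable fun x => flow hC hv 0 x T :=
    ((flow_joint hC hv 0).comp (continuous_id.prodMk continuous_const)).measurable
  have hgm : Measurable fun p : Euc d × ℝ => g (p.2, flow hC hv 0 p.1 p.2) :=
    hg.meas.comp (measurable_snd.prodMk (flow_joint hC hv 0).measurable)
  have hem : Measurable fun x => Real.exp (∫ s in (0:ℝ)..T, g (s, flow hC hv 0 x s)) := by
    refine Real.measurable_exp.comp ?_
    simp_rw [intervalIntegral.integral_of_le hT.1]
    exact (hgm.stronglyMeasurable.integral_prod_right').measurable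
  have hle : ∀ x, Real.exp (∫ s in (0:ℝ)..T, g (s, flow hC hv 0 x s)) ≤
      Real.exp (∫ r, C r) := fun x => Real.exp_le_exp.2 (by
    refine (le_abs_self _).trans ((hg.int_le hC (flow hC hv 0 x) hT.1).trans ?_)
    exact LL_le hC hv.nonneg _ _)
  have hinteg : Integrable (fun x => Real.exp (∫ s in (0:ℝ)..T, g (s, flow hC hv 0 x s))) (μ 0) :=
    integrable_of_bdd _ hem (fun x => by rw [abs_of_pos (Real.exp_pos _)]; exact hle x)
  have hfd := isFiniteMeasure_withDensity_ofReal hinteg.2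
  refine ext_tst _ _ fun φ M R hφ => ?_
  rw [integral_map hfm.aemeasurable hφ.cont.aestronglyMeasurable,
    integral_withDensity_eq_integral_toReal_smul hem.ennreal_ofReal
      (Eventually.of_forall fun x => ENNReal.ofReal_lt_top), hμ.duality hC hv hg hφ hT]
  congr 1; ext x
  rw [ENNReal.toReal_ofReal (Real.exp_pos _).le, smul_eq_mul, mul_comm]; rfl
end Rep

/-- extension of a field by zero outside the open time interval -/
def zext {F : Type*} [Zero F] (u : ℝ × Euc d → F) : ℝ × Euc d → F :=
  (Prod.fst ⁻¹' Ioo (0:ℝ) 1).indicator u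

lemma zext_of_mem {F : Type*} [Zero F] (u : ℝ × Euc d → F) {t : ℝ} (ht : t ∈ Ioo (0:ℝ) 1)
    (x : Euc d) : zext u (t, x) = u (t, x) :=
  indicator_of_mem (show (t, x) ∈ Prod.fst ⁻¹' Ioo (0:ℝ) 1 from ht) u

lemma zext_of_notMem {F : Type*} [Zero F] (u : ℝ × Euc d → F) {t : ℝ} (ht : t ∉ Ioo (0:ℝ) 1)
    (x : Euc d) : zext u (t, x) = 0 :=
  indicator_of_notMem (show (t, x) ∉ Prod.fst ⁻¹' Ioo (0:ℝ) 1 from ht) u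

lemma zext_car {F : Type*} [NormedAddCommGroup F] [MeasurableSpace F] {u : ℝ × Euc d → F}
    (hu : Measurable u) {A D : ℝ → ℝ} (hD : ∀ t ∈ Icc (0:ℝ) 1, A t ≤ D t)
    (hA : ∀ t ∈ Icc (0:ℝ) 1, (∀ x : Euc d, ‖u (t, x)‖ ≤ A t) ∧
      LipschitzWith (Real.toNNReal (A t)) (fun x : Euc d => u (t, x))) :
    Car ((Ioo (0:ℝ) 1).indicator D) (zext u) := by
  refine ⟨hu.indicator (measurable_fst measurableSet_Ioo), fun t x => ?_, fun t x y => ?_⟩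
  · by_cases ht : t ∈ Ioo (0:ℝ) 1
    · have ht' := Ioo_subset_Icc_self ht
      rw [zext_of_mem u ht, indicator_of_mem ht]
      exact ((hA t ht').1 x).trans (hD t ht')
    · rw [zext_of_notMem u ht, indicator_of_notMem ht, norm_zero]
  · by_cases ht : t ∈ Ioo (0:ℝ) 1
    · have ht' := Ioo_subset_Icc_self ht
      rw [zext_of_mem u ht, zext_of_mem u ht, indicator_of_mem ht]
      have h0 : 0 ≤ A t := (norm_nonneg _).trans ((hA t ht').1 x)
      have := (hA t ht').2.dist_le_mul x y
      rw [dist_eq_norm, dist_eq_norm, Real.coe_toNNReal _ h0] at this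
      exact this.trans (mul_le_mul_of_nonneg_right (hD t ht') (norm_nonneg _))
    · rw [zext_of_notMem u ht, zext_of_notMem u ht, indicator_of_notMem ht]
      simp

lemma zext_integral {F : Type*} [NormedAddCommGroup F] [NormedSpace ℝ F]
    (u : ℝ × Euc d → F) (Y : ℝ → Euc d) {t : ℝ}
    (ht : t ∈ Icc (0:ℝ) 1) : ∫ s in (0:ℝ)..t, zext u (s, Y s) = ∫ s in (0:ℝ)..t, u (s, Y s) := by
  rw [intervalIntegral.integral_of_le ht.1, intervalIntegral.integral_of_le ht.1,
    integral_Ioc_eq_integral_Ioo, integral_Ioc_eq_integral_Ioo]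
  refine setIntegral_congr_fun measurableSet_Ioo fun s hs => ?_
  exact zext_of_mem u ⟨hs.1, hs.2.trans_le ht.2⟩ _

/-- **All solutions are push-forwards of the initial datum.**
If `t ↦ ρ_t` is a narrowly continuous positive solution of
`∂ₜ ρ + div (vρ) = gρ` on `(0,1) × ℝ^d`, with `v, g` Borel satisfying the
integrated sup/Lipschitz bounds and `∫₀¹∫ (|v|+|g|) dρ_t dt < ∞`, then for
`ρ₀`-a.e. `x` the ODE `X' = v(t,X)`, `X(0)=x` has a global solution on `[0,1]`
and `ρ_t = (X_·(t))_# (ρ₀ · e^{∫₀ᵗ g(s,X(s)) ds})` for every `t ∈ [0,1]`. -/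
theorem solutions_are_pushforwards (d : ℕ) (hd : 1 ≤ d)
    (v : XX d → Euc d) (g : XX d → ℝ) (hv : Measurable v) (hg : Measurable g)
    (Cv : ℝ → ℝ) (hCvInt : IntegrableOn Cv (Ioo (0:ℝ) 1))
    (hCv : ∀ t ∈ Icc (0:ℝ) 1, (∀ x : Euc d, ‖v (t, x)‖ ≤ Cv t) ∧
      LipschitzWith (Real.toNNReal (Cv t)) (fun x : Euc d => v (t, x)))
    (Cg : ℝ → ℝ) (hCgInt : IntegrableOn Cg (Ioo (0:ℝ) 1))
    (hCg : ∀ t ∈ Icc (0:ℝ) 1, (∀ x : Euc d, |g (t, x)| ≤ Cg t) ∧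
      LipschitzWith (Real.toNNReal (Cg t)) (fun x : Euc d => g (t, x)))
    (ρ : ℝ → Measure (Euc d))
    (hfin : ∀ t ∈ Icc (0:ℝ) 1, ρ t Set.univ ≠ ⊤)
    (hnarrow : ∀ φ : Euc d → ℝ, Continuous φ → (∃ M, ∀ x, |φ x| ≤ M) →
      ContinuousOn (fun t => ∫ x, φ x ∂(ρ t)) (Icc (0:ℝ) 1))
    (hCE : SolvesCE ρ v g)
    (hmom : (∫⁻ t in Ioo (0:ℝ) 1,
      ∫⁻ x, ENNReal.ofReal (‖v (t, x)‖ + |g (t, x)|) ∂(ρ t)) < ⊤) :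
    ∃ X : Euc d → ℝ → Euc d,
      Measurable (fun p : Euc d × ℝ => X p.1 p.2) ∧
      (∀ᵐ x ∂(ρ 0), ∀ t ∈ Icc (0:ℝ) 1,
        X x t = x + ∫ s in (0:ℝ)..t, v (s, X x s)) ∧
      (∀ t ∈ Icc (0:ℝ) 1, ρ t = Measure.map (fun x => X x t)
        ((ρ 0).withDensity fun x =>
          ENNReal.ofReal (Real.exp (∫ s in (0:ℝ)..t, g (s, X x s))))) := by
  have hv0 : ∀ t ∈ Icc (0:ℝ) 1, 0 ≤ Cv t := fun t ht => (norm_nonneg _).trans ((hCv t ht).1 0)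
  have hg0 : ∀ t ∈ Icc (0:ℝ) 1, 0 ≤ Cg t := fun t ht => (abs_nonneg _).trans ((hCg t ht).1 0)
  set C : ℝ → ℝ := (Ioo (0:ℝ) 1).indicator (fun t => Cv t + Cg t) with hCdef
  have hC : Integrable C := (integrable_indicator_iff measurableSet_Ioo).2 (hCvInt.add hCgInt)
  have hvc : Car C (zext v) := zext_car hv (fun t ht => by linarith [hg0 t ht]) hCv
  have hgc : Car C (zext g) := zext_car hg (fun t ht => by linarith [hv0 t ht]) hCg
  let κ : ℝ → ℝ := fun t => max 0 (min 1 t)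
  have hκc : Continuous κ := continuous_const.max (continuous_const.min continuous_id)
  have hκm : ∀ t, κ t ∈ Icc (0:ℝ) 1 := fun t =>
    ⟨le_max_left _ _, max_le zero_le_one (min_le_left _ _)⟩
  have hκe : ∀ t ∈ Icc (0:ℝ) 1, κ t = t := fun t ht => by
    simp only [κ]; rw [min_eq_right ht.2, max_eq_right ht.1]
  have hμfin : ∀ t, IsFiniteMeasure (ρ (κ t)) := fun t =>
    ⟨lt_top_iff_ne_top.2 (hfin _ (hκm t))⟩
  obtain ⟨m, hm⟩ : ∃ m, ∀ t ∈ Icc (0:ℝ) 1, ‖∫ _, (1:ℝ) ∂(ρ t)‖ ≤ m :=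
    isCompact_Icc.exists_bound_of_continuousOn
      (hnarrow (fun _ => 1) continuous_const ⟨1, fun _ => by simp⟩)
  have hμ : Crv (zext v) (zext g) m (fun t => ρ (κ t)) := by
    refine ⟨hμfin, fun t => ?_, fun φ hφ hb => ?_, fun φ hφ => ?_⟩
    · have := hm _ (hκm t)
      rw [integral_const, smul_eq_mul, mul_one] at this
      exact (le_abs_self _).trans this
    · exact (hnarrow φ hφ hb).comp_continuous hκc hκm
    · refine Eq.trans ?_ (hCE φ hφ)
      refine setIntegral_congr_fun measurableSet_Ioo fun t ht => ?_
      simp only [zext_of_mem _ ht, hκe t (Ioo_subset_Icc_self ht)]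
  refine ⟨fun x t => flow hC hvc 0 x t, (flow_joint hC hvc 0).measurable,
    Eventually.of_forall fun x t ht => ?_, fun t ht => ?_⟩
  · rw [← zext_integral v (fun s => flow hC hvc 0 x s) ht]
    exact flow_eq hC hvc 0 x ht.1
  · have h := hμ.repr hC hvc hgc ht
    simp only [hκe t ht, hκe 0 ⟨le_rfl, zero_le_one⟩] at h
    rw [h]
    simp only [zext_integral g _ ht]

end Paper
end
end

section
/- Completeness and separability of the space of cone-valued curves: Let V ⊂ ℝ^d be the closure of a bounded domain. Then (𝒮_V, D) is a complete metric space. If in addition V is convex, then (𝒮_V, D) is separable. -/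
open MeasureTheory Set Filter Topology
open scoped ENNReal NNReal

noncomputable section

namespace Paper

variable {d : ℕ}

/-! ### Auxiliary material for the proof -/

/-- Mass and momentum of a measure. -/
def massMom (μ : Measure (Euc d)) : ℝ × Euc d :=
  (∫ _x, (1:ℝ) ∂μ, WithLp.toLp 2 (fun i => ∫ x, x i ∂μ))

lemma integral_cone (φ : Euc d → ℝ) {a : ℝ} (ha : 0 ≤ a) (x : Euc d) :
    ∫ y, φ y ∂(ENNReal.ofReal a • Measure.dirac x) = a * φ x := by
  rw [integral_smul_measure, integral_dirac, ENNReal.toReal_ofReal ha, smul_eq_mul]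

lemma massMom_cone {a : ℝ} (ha : 0 ≤ a) (x : Euc d) :
    massMom (ENNReal.ofReal a • Measure.dirac x) = (a, a • x) := by
  unfold massMom
  refine Prod.ext ?_ ?_
  · simpa using integral_cone (fun _ => (1:ℝ)) ha x
  · ext i
    simpa using integral_cone (fun y : Euc d => y i) ha x

lemma massMom_inj {V : Set (Euc d)} {μ ν : Measure (Euc d)} (hμ : μ ∈ coneSet V)
    (hν : ν ∈ coneSet V) (h : massMom μ = massMom ν) : μ = ν := by
  obtain ⟨a, x, ha, hx, rfl⟩ := hμ
  obtain ⟨b, y, hb, hy, rfl⟩ := hν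
  rw [massMom_cone ha, massMom_cone hb, Prod.mk.injEq] at h
  obtain ⟨rfl, h2⟩ := h
  rcases eq_or_ne a 0 with rfl | h0
  · simp
  · rw [smul_right_injective _ h0 h2]

/-- Upper bound on a single test. -/
lemma test_le {V : Set (Euc d)} {R : ℝ} (hR : ∀ x ∈ V, ‖x‖ ≤ R)
    {μ ν : Measure (Euc d)} (hμ : μ ∈ coneSet V) (hν : ν ∈ coneSet V)
    {φ : Euc d → ℝ} (h1 : ∀ x, |φ x| ≤ 1) (hL : LipschitzWith 1 φ) :
    (∫ x, φ x ∂μ) - ∫ x, φ x ∂ν ≤ (R + 2) * dist (massMom μ) (massMom ν) := by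
  obtain ⟨a, x, ha, hx, rfl⟩ := hμ
  obtain ⟨b, y, hb, hy, rfl⟩ := hν
  rw [massMom_cone ha, massMom_cone hb, integral_cone _ ha, integral_cone _ hb]
  set D := dist ((a, a • x) : ℝ × Euc d) (b, b • y) with hD
  have hD1 : |a - b| ≤ D := by
    rw [hD, Prod.dist_eq, ← Real.dist_eq]; exact le_max_left _ _
  have hD2 : ‖a • x - b • y‖ ≤ D := by
    rw [hD, Prod.dist_eq, ← dist_eq_norm]; exact le_max_right _ _
  have hy' := hR y hy
  have hl : φ x - φ y ≤ ‖x - y‖ := by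
    have := hL.dist_le_mul x y
    rw [Real.dist_eq, dist_eq_norm] at this
    simp only [NNReal.coe_one, one_mul] at this
    exact (le_abs_self _).trans this
  have e1 : a * ‖x - y‖ ≤ ‖a • x - b • y‖ + |a - b| * ‖y‖ := by
    have : a • (x - y) = (a • x - b • y) - (a - b) • y := by module
    calc a * ‖x - y‖ = ‖a • (x - y)‖ := by rw [norm_smul, Real.norm_of_nonneg ha]
      _ ≤ _ := by
        rw [this]
        refine (norm_sub_le _ _).trans ?_
        rw [norm_smul (a - b) y, Real.norm_eq_abs]
  have e2 : (a - b) * φ y ≤ |a - b| := by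
    refine (le_abs_self _).trans ?_
    rw [abs_mul]
    exact mul_le_of_le_one_right (abs_nonneg _) (h1 y)
  have e3 : a * (φ x - φ y) ≤ a * ‖x - y‖ := mul_le_mul_of_nonneg_left hl ha
  have e4 : |a - b| * ‖y‖ ≤ D * R :=
    mul_le_mul hD1 hy' (norm_nonneg _) ((abs_nonneg _).trans hD1)
  nlinarith

lemma flat_bdd {V : Set (Euc d)} {R : ℝ} (hR : ∀ x ∈ V, ‖x‖ ≤ R)
    {μ ν : Measure (Euc d)} (hμ : μ ∈ coneSet V) (hν : ν ∈ coneSet V) :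
    BddAbove {r : ℝ | ∃ φ : Euc d → ℝ, Continuous φ ∧ (∀ x, |φ x| ≤ 1) ∧ LipschitzWith 1 φ ∧
        r = (∫ x, φ x ∂μ) - ∫ x, φ x ∂ν} := by
  refine ⟨(R + 2) * dist (massMom μ) (massMom ν), ?_⟩
  rintro r ⟨φ, -, h1, hL, rfl⟩
  exact test_le hR hμ hν h1 hL

lemma flat_nonempty (μ ν : Measure (Euc d)) :
    {r : ℝ | ∃ φ : Euc d → ℝ, Continuous φ ∧ (∀ x, |φ x| ≤ 1) ∧ LipschitzWith 1 φ ∧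
        r = (∫ x, φ x ∂μ) - ∫ x, φ x ∂ν}.Nonempty :=
  ⟨0, fun _ => 0, continuous_const, by simp, LipschitzWith.const' 0, by simp⟩

lemma le_flat {V : Set (Euc d)} {R : ℝ} (hR : ∀ x ∈ V, ‖x‖ ≤ R)
    {μ ν : Measure (Euc d)} (hμ : μ ∈ coneSet V) (hν : ν ∈ coneSet V)
    {φ : Euc d → ℝ} (h1 : ∀ x, |φ x| ≤ 1) (hL : LipschitzWith 1 φ) :
    (∫ x, φ x ∂μ) - ∫ x, φ x ∂ν ≤ flatDist μ ν :=
  le_csSup (flat_bdd hR hμ hν) ⟨φ, hL.continuous, h1, hL, rfl⟩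

lemma flat_le {V : Set (Euc d)} {R : ℝ} (hR : ∀ x ∈ V, ‖x‖ ≤ R)
    {μ ν : Measure (Euc d)} (hμ : μ ∈ coneSet V) (hν : ν ∈ coneSet V) :
    flatDist μ ν ≤ (R + 2) * dist (massMom μ) (massMom ν) := by
  refine csSup_le (flat_nonempty μ ν) ?_
  rintro r ⟨φ, -, h1, hL, rfl⟩
  exact test_le hR hμ hν h1 hL

lemma flat_nonneg {V : Set (Euc d)} {R : ℝ} (hR : ∀ x ∈ V, ‖x‖ ≤ R)
    {μ ν : Measure (Euc d)} (hμ : μ ∈ coneSet V) (hν : ν ∈ coneSet V) :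
    0 ≤ flatDist μ ν := by
  simpa using le_flat hR hμ hν (φ := fun _ => 0) (by simp) (LipschitzWith.const' 0)

lemma flat_symm (μ ν : Measure (Euc d)) : flatDist μ ν = flatDist ν μ := by
  have key : ∀ μ ν : Measure (Euc d),
    {r : ℝ | ∃ φ : Euc d → ℝ, Continuous φ ∧ (∀ x, |φ x| ≤ 1) ∧ LipschitzWith 1 φ ∧
        r = (∫ x, φ x ∂μ) - ∫ x, φ x ∂ν} ⊆
    {r : ℝ | ∃ φ : Euc d → ℝ, Continuous φ ∧ (∀ x, |φ x| ≤ 1) ∧ LipschitzWith 1 φ ∧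
        r = (∫ x, φ x ∂ν) - ∫ x, φ x ∂μ} := by
    rintro μ ν r ⟨φ, h0, h1, hL, rfl⟩
    refine ⟨fun x => - φ x, h0.neg, by simpa using h1, hL.neg, ?_⟩
    rw [integral_neg, integral_neg]; ring
  unfold flatDist
  rw [Subset.antisymm (key μ ν) (key ν μ)]

lemma flat_triangle {V : Set (Euc d)} {R : ℝ} (hR : ∀ x ∈ V, ‖x‖ ≤ R)
    {μ ν κ : Measure (Euc d)} (hμ : μ ∈ coneSet V) (hν : ν ∈ coneSet V) (hκ : κ ∈ coneSet V) :
    flatDist μ κ ≤ flatDist μ ν + flatDist ν κ := by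
  refine csSup_le (flat_nonempty μ κ) ?_
  rintro r ⟨φ, -, h1, hL, rfl⟩
  have := le_flat hR hμ hν h1 hL
  have := le_flat hR hν hκ h1 hL
  linarith

/-- Lower bound on the flat distance. -/
lemma dist_le_flat {V : Set (Euc d)} {R : ℝ} (hR1 : 1 ≤ R) (hR : ∀ x ∈ V, ‖x‖ ≤ R)
    {μ ν : Measure (Euc d)} (hμ : μ ∈ coneSet V) (hν : ν ∈ coneSet V) :
    dist (massMom μ) (massMom ν) ≤ R * flatDist μ ν := by
  have hnn := flat_nonneg hR hμ hν
  have t1 := le_flat hR hμ hν (φ := fun _ => 1) (by simp) (LipschitzWith.const' 1)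
  have t2 := le_flat hR hμ hν (φ := fun _ => -1) (by simp) (LipschitzWith.const' (-1))
  have t3 : ∀ e : Euc d, ‖e‖ = 1 →
      (∫ x, max (-1) (min 1 (R⁻¹ * inner ℝ e x)) ∂μ) -
      ∫ x, max (-1) (min 1 (R⁻¹ * inner ℝ e x)) ∂ν ≤ flatDist μ ν := by
    intro e he
    refine le_flat hR hμ hν (φ := fun x => max (-1) (min 1 (R⁻¹ * inner ℝ e x))) ?_ ?_
    · intro x
      rw [abs_le]
      exact ⟨le_max_left _ _, max_le (by norm_num) (min_le_left _ _)⟩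
    · refine LipschitzWith.const_max (LipschitzWith.const_min ?_ _) _
      refine LipschitzWith.of_dist_le_mul fun x y => ?_
      rw [Real.dist_eq, ← mul_sub, ← inner_sub_right, abs_mul, dist_eq_norm, NNReal.coe_one,
        one_mul]
      have h1 : |inner ℝ e (x - y)| ≤ ‖x - y‖ := by
        simpa [he] using abs_real_inner_le_norm e (x - y)
      have h2 : |R⁻¹| ≤ 1 := by
        rw [abs_of_nonneg (by positivity)]; exact inv_le_one_of_one_le₀ hR1
      calc _ ≤ 1 * ‖x - y‖ := mul_le_mul h2 h1 (abs_nonneg _) zero_le_one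
        _ = _ := one_mul _
  obtain ⟨a, x, ha, hx, rfl⟩ := hμ
  obtain ⟨b, y, hb, hy, rfl⟩ := hν
  set F := flatDist (ENNReal.ofReal a • Measure.dirac x) (ENNReal.ofReal b • Measure.dirac y)
  simp only [integral_cone _ ha, integral_cone _ hb] at t1 t2 t3
  rw [massMom_cone ha, massMom_cone hb, Prod.dist_eq]
  have hR0 : 0 < R := by linarith
  refine max_le ?_ ?_
  · change dist a b ≤ _
    rw [Real.dist_eq]
    have : |a - b| ≤ F := abs_le.2 ⟨by linarith, by linarith⟩
    nlinarith
  · change dist (a • x) (b • y) ≤ _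
    rw [dist_eq_norm]
    rcases eq_or_ne (a • x - b • y) 0 with h0 | h0
    · rw [h0, norm_zero]; positivity
    set w := a • x - b • y with hw
    have hwn : ‖w‖ ≠ 0 := norm_ne_zero_iff.2 h0
    have he : ‖(‖w‖⁻¹ • w)‖ = 1 := by
      rw [norm_smul, norm_inv, norm_norm, inv_mul_cancel₀ hwn]
    have t := t3 _ he
    have hclip : ∀ z ∈ V, max (-1) (min 1 (R⁻¹ * inner ℝ (‖w‖⁻¹ • w) z))
        = R⁻¹ * inner ℝ (‖w‖⁻¹ • w) z := by
      intro z hz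
      have h1 : |inner ℝ (‖w‖⁻¹ • w) z| ≤ R := by
        have := abs_real_inner_le_norm (‖w‖⁻¹ • w) z
        rw [he, one_mul] at this
        exact this.trans (hR z hz)
      have h2 : |R⁻¹ * inner ℝ (‖w‖⁻¹ • w) z| ≤ 1 := by
        rw [abs_mul, abs_of_pos (inv_pos.2 hR0), inv_mul_le_iff₀ hR0, mul_one]; exact h1
      rw [abs_le] at h2
      rw [min_eq_right h2.2, max_eq_right h2.1]
    rw [hclip x hx, hclip y hy] at t
    have e : a * (R⁻¹ * inner ℝ (‖w‖⁻¹ • w) x) - b * (R⁻¹ * inner ℝ (‖w‖⁻¹ • w) y)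
        = R⁻¹ * ‖w‖ := by
      have : inner ℝ (‖w‖⁻¹ • w) w = ‖w‖ := by
        rw [inner_smul_left, real_inner_self_eq_norm_sq]
        simp; field_simp
      have h3 : inner ℝ (‖w‖⁻¹ • w) w =
          a * inner ℝ (‖w‖⁻¹ • w) x - b * inner ℝ (‖w‖⁻¹ • w) y := by
        conv_lhs => rw [hw, inner_sub_right, inner_smul_right, inner_smul_right, ← hw]
      have h4 : ‖w‖ = _ := this.symm.trans h3
      linear_combination (-R⁻¹) * h4
    rw [e, inv_mul_le_iff₀ hR0] at t
    exact t

/-- The image of the cone in mass-momentum coordinates. -/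
def coneK (V : Set (Euc d)) : Set (ℝ × Euc d) :=
  {p | ∃ (a : ℝ) (x : Euc d), 0 ≤ a ∧ x ∈ V ∧ p = (a, a • x)}

lemma coneK_closed {V : Set (Euc d)} (hV : IsCompact V) : IsClosed (coneK V) := by
  refine IsSeqClosed.isClosed ?_
  intro p q hp hq
  choose a x ha hx hpe using hp
  obtain ⟨y, hy, s, hs, hsl⟩ := hV.tendsto_subseq hx
  have h1 : Tendsto a atTop (𝓝 q.1) := by
    have := (continuous_fst.tendsto q).comp hq
    refine this.congr fun n => ?_
    simp [hpe n]
  have h2 : Tendsto (fun n => a n • x n) atTop (𝓝 q.2) := by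
    have := (continuous_snd.tendsto q).comp hq
    refine this.congr fun n => ?_
    simp [hpe n]
  refine ⟨q.1, y, ge_of_tendsto' h1 ha, hy, Prod.ext rfl ?_⟩
  exact tendsto_nhds_unique (h2.comp hs.tendsto_atTop) ((h1.comp hs.tendsto_atTop).smul hsl)

lemma coneK_integral_cont {V : Set (Euc d)} (hV : IsCompact V) {φ : Euc d → ℝ}
    (hφ : Continuous φ) :
    ContinuousOn (fun p : ℝ × Euc d => p.1 * φ (p.1⁻¹ • p.2)) (coneK V) := by
  intro p hp
  rcases eq_or_ne p.1 0 with h0 | h0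
  · obtain ⟨M, hM⟩ := hV.exists_bound_of_continuousOn hφ.continuousOn
    have hb : ∀ q ∈ coneK V, ‖q.1 * φ (q.1⁻¹ • q.2)‖ ≤ q.1 * M := by
      rintro q ⟨a, x, ha, hx, rfl⟩
      rcases eq_or_ne a 0 with rfl | h1
      · simp
      · simp only [smul_smul, inv_mul_cancel₀ h1, one_smul]
        rw [norm_mul, Real.norm_of_nonneg ha]
        exact mul_le_mul_of_nonneg_left (hM x hx) ha
    have hval : p.1 * φ (p.1⁻¹ • p.2) = 0 := by rw [h0, zero_mul]
    unfold ContinuousWithinAt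
    beta_reduce
    rw [hval]
    refine squeeze_zero_norm' (a := fun q : ℝ × Euc d => q.1 * M) ?_ ?_
    · filter_upwards [self_mem_nhdsWithin] with q hq using hb q hq
    · have : Tendsto (fun q : ℝ × Euc d => q.1 * M) (𝓝 p) (𝓝 (p.1 * M)) :=
        (continuous_fst.mul continuous_const).tendsto p
      rw [h0, zero_mul] at this
      exact this.mono_left nhdsWithin_le_nhds
  · refine ContinuousAt.continuousWithinAt ?_
    refine continuousAt_fst.mul ?_
    exact hφ.continuousAt.comp ((continuousAt_fst.inv₀ h0).smul continuousAt_snd)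

lemma massMom_mem {V : Set (Euc d)} {μ : Measure (Euc d)} (hμ : μ ∈ coneSet V) :
    massMom μ ∈ coneK V := by
  obtain ⟨a, x, ha, hx, rfl⟩ := hμ
  exact ⟨a, x, ha, hx, massMom_cone ha x⟩

/-- The curve in mass-momentum coordinates. -/
def toCM {V : Set (Euc d)} (η : SCurve V) : C(unitInterval, ℝ × Euc d) where
  toFun t := massMom (η.toFun t)
  continuous_toFun := by
    have : Continuous fun t : ℝ => massMom (η.toFun t) := by
      refine Continuous.prodMk (η.narrow _ continuous_const) ?_
      refine (PiLp.continuous_toLp 2 _).comp (continuous_pi fun i => ?_)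
      exact η.narrow (fun x => x i) (by fun_prop)
    exact this.comp continuous_subtype_val

lemma clamp_eq (t : ℝ) : clamp t = (projIcc (0:ℝ) 1 zero_le_one t : ℝ) := rfl

lemma projIcc_clamp (t : ℝ) :
    projIcc (0:ℝ) 1 zero_le_one (clamp t) = projIcc (0:ℝ) 1 zero_le_one t := by
  rw [clamp_eq, projIcc_val]

lemma toCM_inj {V : Set (Euc d)} {η₁ η₂ : SCurve V} (h : toCM η₁ = toCM η₂) : η₁ = η₂ := by
  have : η₁.toFun = η₂.toFun := by
    funext t
    rw [η₁.clamped, η₂.clamped, clamp_eq]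
    exact massMom_inj (η₁.cone _) (η₂.cone _)
      (DFunLike.congr_fun h (projIcc (0:ℝ) 1 zero_le_one t))
  cases η₁; cases η₂; cases this; rfl

lemma toCM_surj {V : Set (Euc d)} (hV : IsCompact V) (f : C(unitInterval, ℝ × Euc d))
    (hf : ∀ t, f t ∈ coneK V) : ∃ η : SCurve V, toCM η = f := by
  have hnn : ∀ t, 0 ≤ (f t).1 := fun t => by
    obtain ⟨a, x, ha, hx, h⟩ := hf t
    rw [h]; exact ha
  let g : ℝ → ℝ × Euc d := fun t => f (projIcc (0:ℝ) 1 zero_le_one t)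
  have hg : Continuous g := f.continuous.comp continuous_projIcc
  refine ⟨⟨fun t => ENNReal.ofReal (g t).1 • Measure.dirac ((g t).1⁻¹ • (g t).2), ?_, ?_, ?_⟩, ?_⟩
  · intro t
    simp only [g, projIcc_clamp]
  · intro t
    obtain ⟨a, x, ha, hx, h⟩ := hf (projIcc (0:ℝ) 1 zero_le_one t)
    refine ⟨a, x, ha, hx, ?_⟩
    simp only [g, h]
    rcases eq_or_ne a 0 with rfl | h1
    · simp
    · rw [smul_smul, inv_mul_cancel₀ h1, one_smul]
  · intro φ hφ
    have := (coneK_integral_cont hV hφ).comp_continuous hg (fun t => hf _)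
    refine this.congr fun t => ?_
    exact (integral_cone φ (hnn _) _).symm
  · ext1 t
    change massMom (ENNReal.ofReal (g t).1 • Measure.dirac ((g t).1⁻¹ • (g t).2)) = f t
    rw [massMom_cone (a := (g t).1) (hnn _)]
    have hgt : g t = f t := by simp only [g, projIcc_val]
    rw [hgt]
    obtain ⟨a, x, ha, hx, h⟩ := hf t
    rw [h]
    rcases eq_or_ne a 0 with rfl | h1
    · simp
    · simp [smul_smul, h1]

lemma flat_le_toCM {V : Set (Euc d)} {R : ℝ} (hR1 : 1 ≤ R) (hR : ∀ x ∈ V, ‖x‖ ≤ R)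
    (η₁ η₂ : SCurve V) {t : ℝ} (ht : t ∈ Icc (0:ℝ) 1) :
    flatDist (η₁.toFun t) (η₂.toFun t) ≤ (R + 2) * dist (toCM η₁) (toCM η₂) := by
  refine (flat_le hR (η₁.cone t) (η₂.cone t)).trans ?_
  refine mul_le_mul_of_nonneg_left ?_ (by linarith)
  exact ContinuousMap.dist_apply_le_dist (f := toCM η₁) (g := toCM η₂) (⟨t, ht⟩ : unitInterval)

lemma D_nonempty {V : Set (Euc d)} (η₁ η₂ : SCurve V) :
    {r : ℝ | ∃ t ∈ Icc (0:ℝ) 1, r = flatDist (η₁.toFun t) (η₂.toFun t)}.Nonempty :=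
  ⟨_, 0, by simp, rfl⟩

lemma D_le {V : Set (Euc d)} {R : ℝ} (hR1 : 1 ≤ R) (hR : ∀ x ∈ V, ‖x‖ ≤ R)
    (η₁ η₂ : SCurve V) : Ddist η₁ η₂ ≤ (R + 2) * dist (toCM η₁) (toCM η₂) := by
  refine csSup_le (D_nonempty η₁ η₂) ?_
  rintro r ⟨t, ht, rfl⟩
  exact flat_le_toCM hR1 hR η₁ η₂ ht

lemma flat_le_D {V : Set (Euc d)} {R : ℝ} (hR1 : 1 ≤ R) (hR : ∀ x ∈ V, ‖x‖ ≤ R)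
    (η₁ η₂ : SCurve V) {t : ℝ} (ht : t ∈ Icc (0:ℝ) 1) :
    flatDist (η₁.toFun t) (η₂.toFun t) ≤ Ddist η₁ η₂ := by
  refine le_csSup ⟨(R + 2) * dist (toCM η₁) (toCM η₂), ?_⟩ ⟨t, ht, rfl⟩
  rintro r ⟨t, ht, rfl⟩
  exact flat_le_toCM hR1 hR η₁ η₂ ht

lemma D_nonneg {V : Set (Euc d)} {R : ℝ} (hR1 : 1 ≤ R) (hR : ∀ x ∈ V, ‖x‖ ≤ R)
    (η₁ η₂ : SCurve V) : 0 ≤ Ddist η₁ η₂ :=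
  (flat_nonneg hR (η₁.cone 0) (η₂.cone 0)).trans
    (flat_le_D hR1 hR η₁ η₂ (by simp))

lemma dist_le_D {V : Set (Euc d)} {R : ℝ} (hR1 : 1 ≤ R) (hR : ∀ x ∈ V, ‖x‖ ≤ R)
    (η₁ η₂ : SCurve V) : dist (toCM η₁) (toCM η₂) ≤ R * Ddist η₁ η₂ := by
  have hR0 : 0 ≤ R := by linarith
  rw [ContinuousMap.dist_le (mul_nonneg hR0 (D_nonneg hR1 hR η₁ η₂))]
  intro t
  refine (dist_le_flat hR1 hR (η₁.cone t) (η₂.cone t)).trans ?_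
  exact mul_le_mul_of_nonneg_left (flat_le_D hR1 hR η₁ η₂ t.2) hR0

/-- **Completeness and separability of `(𝒮_V, D)`.**
`(𝒮_V, D)` is a complete metric space, and if `V` is convex it is separable. -/
theorem SCurve_complete_separable (d : ℕ) (hd : 1 ≤ d) (V : Set (Euc d))
    (hV : IsClosureOfBoundedDomain V) :
    ((∀ η₁ η₂ : SCurve V, Ddist η₁ η₂ = 0 ↔ η₁ = η₂) ∧
     (∀ η₁ η₂ : SCurve V, Ddist η₁ η₂ = Ddist η₂ η₁) ∧
     (∀ η₁ η₂ η₃ : SCurve V, Ddist η₁ η₃ ≤ Ddist η₁ η₂ + Ddist η₂ η₃) ∧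
     (∀ u : ℕ → SCurve V,
        (∀ ε : ℝ, 0 < ε → ∃ N, ∀ m ≥ N, ∀ n ≥ N, Ddist (u m) (u n) < ε) →
        ∃ η : SCurve V, Tendsto (fun n => Ddist (u n) η) atTop (nhds 0))) ∧
    (Convex ℝ V → ∃ S : Set (SCurve V), S.Countable ∧
      ∀ η : SCurve V, ∀ ε : ℝ, 0 < ε → ∃ η' ∈ S, Ddist η η' < ε) := by
  obtain ⟨U, -, -, -, hUb, hVU⟩ := hV
  have hVc : IsCompact V := by
    rw [hVU]; exact hUb.isCompact_closure
  obtain ⟨R₀, hR₀⟩ := hVc.isBounded.exists_norm_le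
  obtain ⟨R, hR1, hR⟩ : ∃ R : ℝ, 1 ≤ R ∧ ∀ x ∈ V, ‖x‖ ≤ R :=
    ⟨max 1 R₀, le_max_left _ _, fun x hx => (hR₀ x hx).trans (le_max_right _ _)⟩
  refine ⟨⟨?_, ?_, ?_, ?_⟩, ?_⟩
  · intro η₁ η₂
    constructor
    · intro h
      have := dist_le_D hR1 hR η₁ η₂
      rw [h, mul_zero] at this
      exact toCM_inj (dist_le_zero.1 this)
    · rintro rfl
      have := D_le hR1 hR η₁ η₁
      rw [dist_self, mul_zero] at this
      exact le_antisymm this (D_nonneg hR1 hR η₁ η₁)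
  · intro η₁ η₂
    unfold Ddist
    simp only [flat_symm]
  · intro η₁ η₂ η₃
    refine csSup_le (D_nonempty η₁ η₃) ?_
    rintro r ⟨t, ht, rfl⟩
    exact (flat_triangle hR (η₁.cone t) (η₂.cone t) (η₃.cone t)).trans
      (add_le_add (flat_le_D hR1 hR _ _ ht) (flat_le_D hR1 hR _ _ ht))
  · intro u hu
    have hc : CauchySeq fun n => toCM (u n) := by
      rw [Metric.cauchySeq_iff]
      intro ε hε
      obtain ⟨N, hN⟩ := hu (ε / R) (by positivity)
      refine ⟨N, fun m hm n hn => (dist_le_D hR1 hR _ _).trans_lt ?_⟩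
      have := hN m hm n hn
      rwa [lt_div_iff₀' (by linarith)] at this
    obtain ⟨f, hf⟩ := cauchySeq_tendsto_of_complete hc
    obtain ⟨η, rfl⟩ := toCM_surj hVc f (fun t => by
      have ht : Tendsto (fun n => toCM (u n) t) atTop (𝓝 (f t)) :=
        ((continuous_eval_const t).tendsto f).comp hf
      exact (coneK_closed hVc).mem_of_tendsto ht
        (Eventually.of_forall fun n => massMom_mem ((u n).cone t)))
    refine ⟨η, ?_⟩
    have h0 := (tendsto_iff_dist_tendsto_zero.1 hf).const_mul (R + 2)
    rw [mul_zero] at h0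
    exact squeeze_zero (fun n => D_nonneg hR1 hR _ _) (fun n => D_le hR1 hR _ _) h0
  · intro _
    have hsep : TopologicalSpace.IsSeparable (range (toCM (V := V))) :=
      TopologicalSpace.IsSeparable.of_separableSpace _
    obtain ⟨T, hTs, hTc, hTd⟩ := hsep.exists_countable_dense_subset
    refine ⟨toCM ⁻¹' T, hTc.preimage_of_injOn (fun _ _ _ _ h => toCM_inj h), ?_⟩
    intro η ε hε
    obtain ⟨f, hfT, hfd⟩ := Metric.mem_closure_iff.1 (hTd (mem_range_self η)) (ε / (R + 2))
      (by positivity)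
    obtain ⟨η', rfl⟩ := hTs hfT
    refine ⟨η', hfT, (D_le hR1 hR _ _).trans_lt ?_⟩
    rwa [lt_div_iff₀' (by linarith)] at hfd

end Paper
end
end
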